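/- arXiv:1402.1569 — 5 statements merged into one kernel-verified Lean document; each statement's English description precedes it below -/
import Mathlib

section
/- Let f_0, f_1, …, f_l be real-valued functions that are l times continuously differentiable at a point x, and for any subfamily (g_1, …, g_k) write W(g_1, …, g_k)(x) = det( g_j^{(i)}(x) )_{i=0,…,k−1; j=1,…,k} for their Wronskian. Then the following identity (a consequence of Sylvester's determinant identity) holds: W(f_0, f_1, …, f_l)(x) · W(f_1, …, f_{l−1})(x) = W(f_0, …, f_{l−1})(x) · W′(f_1, …, f_l)(x) − W′(f_0, …, f_{l−1})(x) · W(f_1, …, f_l)(x), where ′ denotes the derivative with respect to x. -/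
open Polynomial

/-- The Wronskian `x ↦ det ((f j)^(i) (x))_{i,j}` of a finite family of functions. -/
noncomputable def funWronskian {k : ℕ} (f : Fin k → ℝ → ℝ) : ℝ → ℝ := fun x =>
  Matrix.det (Matrix.of fun i j : Fin k => iteratedDeriv (i : ℕ) (f j) x)

open Matrix in
theorem aux_plucker {n : Type*} [Fintype n] [DecidableEq n] (A : Matrix n n ℝ) (p q : n) (hpq : p ≠ q)
    (u v : n → ℝ) :
    A.det * ((A.updateCol q v).updateCol p u).det =
      (A.updateCol p u).det * (A.updateCol q v).det
        - (A.updateCol q u).det * (A.updateCol p v).det := by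
  set B := A.updateCol q v with hB
  have h1 : A.det * (B.updateCol p u).det = ∑ i, cramer A u i * cramer B (fun k => A k i) p := by
    rw [← cramer_apply B u p, ← smul_eq_mul, ← Pi.smul_apply, ← map_smul, ← mulVec_cramer]
    have : A *ᵥ cramer A u = ∑ i, cramer A u i • (fun k => A k i) := by
      ext k
      simp [mulVec, dotProduct, mul_comm]
    rw [this, map_sum, Finset.sum_apply]
    simp
  rw [h1, Finset.sum_eq_add p q hpq]
  · have e1 : cramer B (fun k => A k p) p = B.det := by
      rw [cramer_row_self B _ p]
      · simp
      · intro j; simp [hB, hpq]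
    have e2 : cramer B (fun k => A k q) p = - (A.updateCol p v).det := by
      have h := det_permute' (Equiv.swap p q) (A.updateCol p v)
      rw [Equiv.Perm.sign_swap hpq] at h
      have : B.updateCol p (fun k => A k q) = (A.updateCol p v).submatrix id (Equiv.swap p q) := by
        ext i j
        by_cases hp : j = p
        · subst hp; simp [hpq.symm]
        · by_cases hq : j = q
          · subst hq; simp [hB, hp]
          · simp [hB, hp, hq, Equiv.swap_apply_of_ne_of_ne]
      rw [cramer_apply, this, h]
      simp
    rw [e1, e2, cramer_apply, cramer_apply]
    ring
  · rintro i - ⟨hp, hq⟩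
    rw [cramer_row_self B _ i]
    · simp [hp.symm]
    · intro j; simp [hB, hq]
  · simp
  · simp

open Matrix in
theorem aux_minor {n : ℕ} (A : Matrix (Fin (n+1)) (Fin (n+1)) ℝ) (p i : Fin (n+1)) :
    (A.updateCol p (Pi.single i 1)).det =
      (-1) ^ (i + p : ℕ) * det (A.submatrix i.succAbove p.succAbove) := by
  rw [← adjugate_fin_succ_eq_det_submatrix, ← cramer_apply, cramer_eq_adjugate_mulVec,
    mulVec_single_one]
  rfl

open Matrix in
theorem aux_sylvester (m : ℕ) (A : Matrix (Fin (m+2)) (Fin (m+2)) ℝ) :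
    A.det * (A.submatrix (fun i : Fin m => i.castSucc.castSucc) (fun j => j.castSucc.succ)).det =
      (A.submatrix Fin.castSucc Fin.castSucc).det *
        (A.submatrix (Fin.last m).castSucc.succAbove Fin.succ).det -
      (A.submatrix (Fin.last m).castSucc.succAbove Fin.castSucc).det *
        (A.submatrix Fin.castSucc Fin.succ).det := by
  have h0 : (0 : Fin (m+2)) ≠ Fin.last (m+1) := by simp [Fin.ext_iff]
  have h := aux_plucker A 0 (Fin.last (m+1)) h0
    (Pi.single (Fin.last m).castSucc 1) (Pi.single (Fin.last (m+1)) 1)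
  have hD : ((A.updateCol (Fin.last (m+1)) (Pi.single (Fin.last (m+1)) 1)).updateCol 0
      (Pi.single (Fin.last m).castSucc 1)).det = (-1)^m *
      (A.submatrix (fun i : Fin m => i.castSucc.castSucc) (fun j => j.castSucc.succ)).det := by
    rw [updateCol_comm _ h0.symm, aux_minor]
    have : ((A.updateCol 0 (Pi.single (Fin.last m).castSucc 1)).submatrix
        (Fin.last (m+1)).succAbove (Fin.last (m+1)).succAbove) =
        (A.submatrix Fin.castSucc Fin.castSucc).updateCol 0 (Pi.single (Fin.last m) 1) := by
      ext i j
      by_cases hj : j = 0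
      · subst hj
        simp [Pi.single_apply]
      · have : j.castSucc ≠ 0 := fun h => hj (Fin.castSucc_injective _ (by simpa using h))
        simp [hj, this]
    rw [this, aux_minor]
    have hs : ((-1:ℝ)) ^ (((Fin.last (m+1) : Fin (m+2)) : ℕ) + (Fin.last (m+1) : Fin (m+2))) = 1 :=
      Even.neg_one_pow ⟨_, rfl⟩
    rw [hs, one_mul]
    simp only [Fin.val_last, Fin.val_zero, add_zero, submatrix_submatrix]
    congr 2
    ext i j
    simp
  rw [hD, aux_minor, aux_minor, aux_minor, aux_minor] at h
  simp only [Fin.succAbove_last, Fin.succAbove_zero, Fin.val_last, Fin.val_zero, add_zero,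
    Fin.val_castSucc] at h
  have hs : ((-1:ℝ)) ^ (m + 1 + (m + 1)) = 1 := Even.neg_one_pow ⟨_, rfl⟩
  have hs2 : ((-1:ℝ)) ^ (m + (m + 1)) = -1 := Odd.neg_one_pow ⟨m, by ring⟩
  rw [hs, hs2, pow_succ] at h
  have hne : ((-1:ℝ))^m ≠ 0 := pow_ne_zero _ (by norm_num)
  apply mul_left_cancel₀ hne
  linear_combination h

theorem aux_deriv (m : ℕ) (g : Fin (m+1) → ℝ → ℝ) (x : ℝ)
    (hg : ∀ j, ContDiffAt ℝ (m+1 : ℕ) (g j) x) :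
    deriv (funWronskian g) x = Matrix.det (Matrix.of fun i j : Fin (m+1) =>
      iteratedDeriv ((Fin.last m).castSucc.succAbove i : Fin (m+2)) (g j) x) := by
  let F : ContinuousMultilinearMap ℝ (fun _ : Fin (m+1) => (Fin (m+1) → ℝ)) ℝ :=
    { (Matrix.detRowAlternating (n := Fin (m+1)) (R := ℝ)).toMultilinearMap with
      cont := by
        exact Continuous.matrix_det (A := fun M : Matrix (Fin (m+1)) (Fin (m+1)) ℝ => M)
          continuous_id }
  have hF : ∀ M : Fin (m+1) → Fin (m+1) → ℝ, F M = Matrix.det (Matrix.of M) := fun _ => rfl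
  have hd : ∀ i : Fin (m+1), HasFDerivAt (fun y => fun j => iteratedDeriv (i:ℕ) (g j) y)
      (ContinuousLinearMap.toSpanSingleton ℝ (fun j => iteratedDeriv ((i:ℕ)+1) (g j) x)) x := by
    intro i
    rw [← hasDerivAt_iff_hasFDerivAt]
    rw [hasDerivAt_pi]
    intro j
    rw [iteratedDeriv_succ]
    apply DifferentiableAt.hasDerivAt
    rw [iteratedDeriv_eq_equiv_comp]
    have h1 : DifferentiableAt ℝ (iteratedFDeriv ℝ (i:ℕ) (g j)) x :=
      (hg j).differentiableAt_iteratedFDeriv (by exact_mod_cast i.2)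
    exact ((ContinuousMultilinearMap.piFieldEquiv ℝ (Fin i) ℝ).symm.differentiable.differentiableAt).comp x h1
  have h := (HasFDerivAt.multilinear_comp F hd).hasDerivAt.deriv
  have he : funWronskian g = fun y => F (fun i j => iteratedDeriv (i:ℕ) (g j) y) := rfl
  rw [he, h]
  simp only [ContinuousLinearMap.sum_apply, ContinuousLinearMap.comp_apply,
    ContinuousLinearMap.toSpanSingleton_apply, one_smul,
    ContinuousMultilinearMap.toContinuousLinearMap_apply, hF]
  rw [Finset.sum_eq_single (Fin.last m)]
  · congr 2
    ext i j
    induction i using Fin.lastCases with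
    | last => simp
    | cast i => simp [Fin.succAbove_of_castSucc_lt, Fin.lt_def, Function.update_of_ne, (Fin.castSucc_lt_last i).ne]
  · intro b _ hb
    obtain ⟨c, rfl⟩ := Fin.exists_castSucc_eq.mpr hb
    apply Matrix.det_zero_of_row_eq (i := c.castSucc) (j := c.succ) (Fin.castSucc_lt_succ).ne
    ext j
    simp [Function.update_of_ne, (Fin.castSucc_lt_succ (i := c)).ne']
  · simp

/-- for functions `f 0, …, f l` that are `l` times continuously
differentiable at `x`, the Wronskian identity (a consequence of Sylvester's determinant
identity)
`W(f_0,…,f_l) ⬝ W(f_1,…,f_{l-1}) = W(f_0,…,f_{l-1}) ⬝ W′(f_1,…,f_l) − W′(f_0,…,f_{l-1}) ⬝ W(f_1,…,f_l)`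
holds at `x`. -/
theorem wronskian_sylvester_identity (l : ℕ) (hl : 1 ≤ l)
    (f : Fin (l + 1) → ℝ → ℝ) (x : ℝ)
    (hf : ∀ j, ContDiffAt ℝ l (f j) x) :
    funWronskian f x * funWronskian (fun j : Fin (l - 1) => f ⟨(j : ℕ) + 1, by omega⟩) x =
      funWronskian (fun j : Fin l => f j.castSucc) x *
          deriv (funWronskian (fun j : Fin l => f j.succ)) x -
        deriv (funWronskian (fun j : Fin l => f j.castSucc)) x *
          funWronskian (fun j : Fin l => f j.succ) x := by
  obtain ⟨m, rfl⟩ : ∃ m, l = m + 1 := ⟨l - 1, by omega⟩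
  rw [aux_deriv m _ x (fun j => hf _), aux_deriv m _ x (fun j => hf _)]
  exact aux_sylvester m (Matrix.of fun i j : Fin (m+2) => iteratedDeriv (i : ℕ) (f j) x)
end

section
/- Suppose the weights (w_1, …, w_r) form an AT system on [a,b] for every multi-index in ℕ^r, let n⃗ be a multi-index with N = |n⃗|, and assume the normalizing constant Z_N = ∫_{[a,b]^N} det(x_j^{i−1})_{i,j=1}^N det(g_i(x_j))_{i,j=1}^N dx_1⋯dx_N is nonzero. Then for every m ≥ 1, every path (n⃗_0, …, n⃗_{m−1}) of length m starting at n⃗, and every z ∈ ℂ, the m-th moment of the average characteristic polynomial satisfies E[ ∏_{k=1}^N (z − x_k)^m ] = (∏_{i=0}^{m−1} i!)^{−1} · det( P_{n⃗_j}^{(i)}(z) )_{i,j=0}^{m−1}, where E[F] = (1/Z_N) ∫_{[a,b]^N} F(x_1,…,x_N) det(x_j^{i−1})_{i,j=1}^N det(g_i(x_j))_{i,j=1}^N dx_1⋯dx_N. -/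
open MeasureTheory Polynomial Finset

/-- The system of weights `w` forms an AT (algebraic Chebyshev) system on the interval `E`
for the multi-index `n`: every nontrivial linear combination of the functions
`x^i * w j x` (`i < n j`), i.e. every nontrivial `∑ j, q j (x) * w j x` with
`deg (q j) ≤ n j - 1`, has at most `|n| - 1` zeros on `E`. -/
def IsATSystemFor {r : ℕ} (E : Set ℝ) (w : Fin r → ℝ → ℝ) (n : Fin r → ℕ) : Prop :=
  ∀ q : Fin r → Polynomial ℝ, (∀ j, (q j).degree < (n j : WithBot ℕ)) → (∃ j, q j ≠ 0) →
    {x ∈ E | ∑ j, (q j).eval x * w j x = 0}.Finite ∧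
    {x ∈ E | ∑ j, (q j).eval x * w j x = 0}.ncard + 1 ≤ ∑ j, n j

/-- `P` is the type II multiple orthogonal polynomial on `E` for the weights `w` and the
multi-index `n`: it is monic of degree `|n|` and `∫ P(x) x^k w j (x) dx = 0` for all
`k < n j`. -/
def IsTypeII {r : ℕ} (E : Set ℝ) (w : Fin r → ℝ → ℝ) (n : Fin r → ℕ)
    (P : Polynomial ℝ) : Prop :=
  P.Monic ∧ P.natDegree = ∑ j, n j ∧
    ∀ j : Fin r, ∀ k < n j, ∫ x in E, P.eval x * x ^ k * w j x = 0

/-- `p` is a path of multi-indices of length `l` starting at `n`: `p 0 = n`,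
`|p j| = |n| + j`, and `p` is monotone componentwise. -/
def IsPath {r : ℕ} (l : ℕ) (n : Fin r → ℕ) (p : Fin l → Fin r → ℕ) : Prop :=
  (∀ h : 0 < l, p ⟨0, h⟩ = n) ∧
    (∀ j : Fin l, ∑ i, p j i = (∑ i, n i) + (j : ℕ)) ∧
    (∀ j k : Fin l, j ≤ k → ∀ i, p j i ≤ p k i)

/-- The Wronskian `det (P j ^ (i))_{i,j}` of a family of polynomials. -/
noncomputable def polyWronskian {l : ℕ} (P : Fin l → Polynomial ℝ) : Polynomial ℝ :=
  Matrix.det (Matrix.of fun i j : Fin l => Polynomial.derivative^[(i : ℕ)] (P j))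



lemma det_monic_change {n : ℕ} (p : Fin n → ℂ[X])
    (h_deg : ∀ i, (p i).natDegree = i) (h_monic : ∀ i, (p i).Monic) (L : Fin n → ℂ[X] →ₗ[ℂ] ℂ) :
    (Matrix.of fun i j => L i (p j)).det = (Matrix.of fun i j : Fin n => L i (X ^ (j : ℕ))).det := by
  have h : (Matrix.of fun i j => L i (p j)) =
      (Matrix.of fun i j : Fin n => L i (X ^ (j : ℕ))) *
        (Matrix.of (fun (i j : Fin n) => (p j).coeff i)) := by
    ext i j
    simp only [Matrix.mul_apply, Matrix.of_apply]
    have h1 : p j = ∑ k : Fin n, (p j).coeff k • (X ^ (k : ℕ) : ℂ[X]) := by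
      conv_lhs => rw [(p j).as_sum_range' n (by rw [h_deg]; exact j.2)]
      rw [← Fin.sum_univ_eq_sum_range (fun k => monomial k ((p j).coeff k)) n]
      simp [smul_X_eq_monomial]
    conv_lhs => rw [h1]
    rw [map_sum]
    simp [mul_comm]
  rw [h, Matrix.det_mul, Matrix.det_matrixOfPolynomials p h_deg h_monic, mul_one]

lemma det_monic_change_sum {N m : ℕ} (p q : Fin N ⊕ Fin m → ℂ[X])
    (hp : ∀ i, (p i).natDegree = finSumFinEquiv i) (hpm : ∀ i, (p i).Monic)
    (hq : ∀ i, (q i).natDegree = finSumFinEquiv i) (hqm : ∀ i, (q i).Monic)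
    (L : Fin N ⊕ Fin m → ℂ[X] →ₗ[ℂ] ℂ) :
    (Matrix.of fun i j => L i (p j)).det = (Matrix.of fun i j => L i (q j)).det := by
  have key : ∀ p : Fin N ⊕ Fin m → ℂ[X], (∀ i, (p i).natDegree = finSumFinEquiv i) →
      (∀ i, (p i).Monic) → (Matrix.of fun i j => L i (p j)).det =
      (Matrix.of fun i j : Fin (N + m) => L (finSumFinEquiv.symm i) (X ^ (j : ℕ))).det := by
    intro p hp hpm
    rw [← det_monic_change (fun i => p (finSumFinEquiv.symm i)) (by intro i; simp [hp])
      (fun i => hpm _)]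
    rw [← Matrix.det_submatrix_equiv_self finSumFinEquiv.symm]
    rfl
  rw [key p hp hpm, key q hq hqm]

/-- functionals : evaluation at the points, then derivatives at `z` -/
noncomputable def evF {N m : ℕ} (x : Fin N → ℂ) (z : ℂ) : Fin N ⊕ Fin m → ℂ[X] →ₗ[ℂ] ℂ :=
  Sum.elim (fun j => Polynomial.leval (x j))
    (fun l => Polynomial.leval z ∘ₗ (Polynomial.derivative (R := ℂ)) ^ (l : ℕ))

lemma evF_inl {N m : ℕ} (x : Fin N → ℂ) (z : ℂ) (j : Fin N) (p : ℂ[X]) :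
    evF (m := m) x z (Sum.inl j) p = p.eval (x j) := rfl

lemma evF_inr {N m : ℕ} (x : Fin N → ℂ) (z : ℂ) (l : Fin m) (p : ℂ[X]) :
    evF (m := m) x z (Sum.inr l) p = (derivative^[(l : ℕ)] p).eval z := by
  simp [evF, Module.End.pow_apply]

lemma confluent {N m : ℕ} (x : Fin N → ℂ) (z : ℂ) (Q : Fin m → ℂ[X])
    (hQ : ∀ j, (Q j).natDegree = N + j) (hQm : ∀ j, (Q j).Monic) :
    (Matrix.of fun i j => evF (m := m) x z i
      (Sum.elim (fun k : Fin N => (X ^ (k : ℕ) : ℂ[X])) Q j)).det =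
    (Matrix.of fun i j : Fin N => x j ^ (i : ℕ)).det * (∏ k, (z - x k) ^ m) *
      ∏ i ∈ Finset.range m, (Nat.factorial i : ℂ) := by
  have hmon : (∏ k, (X - C (x k))).Monic := monic_prod_of_monic _ _ fun k _ => monic_X_sub_C _
  have hdeg : (∏ k, (X - C (x k))).natDegree = N := by
    rw [natDegree_prod_of_monic _ _ fun k _ => monic_X_sub_C _]; simp
  rw [det_monic_change_sum _ (Sum.elim (fun k : Fin N => (X ^ (k : ℕ) : ℂ[X]))
    (fun l : Fin m => (X - C z) ^ (l : ℕ) * ∏ k, (X - C (x k))))]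
  · set A : Matrix (Fin N) (Fin N) ℂ := Matrix.of fun i j => x i ^ (j : ℕ)
    set B : Matrix (Fin m) (Fin N) ℂ := Matrix.of fun i j =>
      (derivative^[(i : ℕ)] (X ^ (j : ℕ) : ℂ[X])).eval z
    set D : Matrix (Fin m) (Fin m) ℂ := Matrix.of fun i j =>
      (derivative^[(i : ℕ)] ((X - C z) ^ (j : ℕ) * ∏ k, (X - C (x k)) : ℂ[X])).eval z with hD
    have hM : (Matrix.of fun i j => evF (m := m) x z i
        (Sum.elim (fun k : Fin N => (X ^ (k : ℕ) : ℂ[X]))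
          (fun l : Fin m => (X - C z) ^ (l : ℕ) * ∏ k, (X - C (x k))) j)) =
        Matrix.fromBlocks A 0 B D := by
      ext (i | i) (j | j)
      · simp [A, evF_inl]
      · simp only [Matrix.of_apply, Sum.elim_inr, evF_inl, Matrix.fromBlocks_apply₁₂,
          Matrix.zero_apply, eval_mul, eval_prod]
        rw [Finset.prod_eq_zero (Finset.mem_univ i) (by simp), mul_zero]
      · simp [B, evF_inr]
      · simp [D, evF_inr]
    rw [hM, Matrix.det_fromBlocks_zero₁₂, mul_assoc]
    congr 1
    · rw [← Matrix.det_transpose]; rfl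
    · rw [Matrix.det_of_isLowerTriangular]
      · have : ∀ i : Fin m, D i i = (∏ k, (z - x k)) * (Nat.factorial (i : ℕ) : ℂ) := by
          intro i
          have := aeval_iterate_derivative_self (R := ℂ) (A := ℂ)
            ((X - C z) ^ (i : ℕ) * ∏ k, (X - C (x k))) (i : ℕ) z
            (p' := ∏ k, (X - C (x k))) (by simp)
          simp only [coe_aeval_eq_eval] at this
          simp only [D, Matrix.of_apply, this, eval_prod]
          simp [mul_comm]
        simp only [this, Finset.prod_mul_distrib]
        rw [Fin.prod_univ_eq_prod_range (fun i => (Nat.factorial i : ℂ)) m]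
        simp [Finset.prod_pow]
      · intro i j hij
        have hij : i < j := hij
        have := aeval_iterate_derivative_of_lt (R := ℂ) (A := ℂ)
            ((X - C z) ^ (j : ℕ) * ∏ k, (X - C (x k))) (j : ℕ) z
            (p' := ∏ k, (X - C (x k))) (by simp) (k := i) hij
        simp only [coe_aeval_eq_eval] at this
        exact this
  · rintro (i | i) <;> simp [hQ]
  · rintro (i | i) <;> simp [hQm, monic_X_pow]
  · rintro (i | i)
    · simp
    · simp only [Sum.elim_inr, finSumFinEquiv_apply_right, Fin.val_natAdd]
      rw [((monic_X_sub_C z).pow _).natDegree_mul hmon, hdeg,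
        (monic_X_sub_C z).natDegree_pow]
      simp [add_comm]
  · rintro (i | i)
    · simp [monic_X_pow]
    · exact ((monic_X_sub_C z).pow _).mul hmon

lemma andreief {N : ℕ} {κ : Type} [Fintype κ] [DecidableEq κ] (μ : Measure ℝ) [SigmaFinite μ]
    (f : Fin N ⊕ κ → ℝ → ℂ) (g : Fin N → ℝ → ℂ) (B : κ → Fin N ⊕ κ → ℂ)
    (hint : ∀ k i, Integrable (fun x => f k x * g i x) μ) :
    ∫ x : Fin N → ℝ, (Matrix.of (Sum.elim (fun j k => f k (x j)) B)).det *
      (Matrix.of fun i j => g i (x j)).det ∂(Measure.pi fun _ => μ) =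
    (Nat.factorial N : ℂ) *
      (Matrix.of (Sum.elim (fun j k => ∫ t, f k t * g j t ∂μ) B)).det := by
  have hexp : ∀ A : Fin N → Fin N ⊕ κ → ℂ, (Matrix.of (Sum.elim A B)).det =
      ∑ τ : Equiv.Perm (Fin N ⊕ κ), ((Equiv.Perm.sign τ : ℤ) : ℂ) *
        ((∏ j, A j (τ (Sum.inl j))) * ∏ l, B l (τ (Sum.inr l))) := by
    intro A
    rw [← Matrix.det_transpose, Matrix.det_apply']
    simp [Fintype.prod_sum_type]
  have hperm : ∀ σ : Equiv.Perm (Fin N), ∀ A : Fin N → Fin N ⊕ κ → ℂ,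
      (Matrix.of (Sum.elim (fun j => A (σ j)) B)).det =
        ((Equiv.Perm.sign σ : ℤ) : ℂ) * (Matrix.of (Sum.elim A B)).det := by
    intro σ A
    have := Matrix.det_permute (Equiv.sumCongr σ (Equiv.refl κ)) (Matrix.of (Sum.elim A B))
    rw [Equiv.Perm.sign_sumCongr] at this
    simp only [Equiv.Perm.sign_refl, mul_one] at this
    rw [← this]
    congr 1
    ext (i | i) j <;> rfl
  have hpt : ∀ x : Fin N → ℝ, (Matrix.of (Sum.elim (fun j k => f k (x j)) B)).det *
      (Matrix.of fun i j => g i (x j)).det =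
      ∑ σ : Equiv.Perm (Fin N), ∑ τ : Equiv.Perm (Fin N ⊕ κ),
        (((Equiv.Perm.sign σ : ℤ) : ℂ) * ((Equiv.Perm.sign τ : ℤ) : ℂ) *
          ∏ l, B l (τ (Sum.inr l))) *
        ∏ j, (f (τ (Sum.inl j)) (x j) * g (σ j) (x j)) := by
    intro x
    rw [hexp, Matrix.det_apply', Finset.sum_mul_sum, Finset.sum_comm]
    refine Finset.sum_congr rfl fun σ _ => Finset.sum_congr rfl fun τ _ => ?_
    rw [Finset.prod_mul_distrib]
    simp only [Matrix.of_apply]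
    ring
  have hI : ∀ (σ : Equiv.Perm (Fin N)) (τ : Equiv.Perm (Fin N ⊕ κ)),
      Integrable (fun x : Fin N → ℝ =>
        ∏ j, (f (τ (Sum.inl j)) (x j) * g (σ j) (x j))) (Measure.pi fun _ => μ) := fun σ τ =>
    Integrable.fintype_prod (f := fun j t => f (τ (Sum.inl j)) t * g (σ j) t) fun j => hint _ _
  simp only [hpt]
  rw [integral_finsetSum _ fun σ _ => integrable_finsetSum _ fun τ _ => (hI σ τ).const_mul _]
  have hσ : ∀ σ : Equiv.Perm (Fin N), (∫ x : Fin N → ℝ, ∑ τ : Equiv.Perm (Fin N ⊕ κ),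
        (((Equiv.Perm.sign σ : ℤ) : ℂ) * ((Equiv.Perm.sign τ : ℤ) : ℂ) *
          ∏ l, B l (τ (Sum.inr l))) *
        ∏ j, (f (τ (Sum.inl j)) (x j) * g (σ j) (x j)) ∂(Measure.pi fun _ => μ)) =
      (Matrix.of (Sum.elim (fun j k => ∫ t, f k t * g j t ∂μ) B)).det := by
    intro σ
    rw [integral_finsetSum _ fun τ _ => (hI σ τ).const_mul _]
    have h2 := hperm σ (fun j k => ∫ t, f k t * g j t ∂μ)
    rw [hexp] at h2
    have h3 : ((Equiv.Perm.sign σ : ℤ) : ℂ) * ((Equiv.Perm.sign σ : ℤ) : ℂ) = 1 := by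
      rcases Int.units_eq_one_or (Equiv.Perm.sign σ) with h | h <;> simp [h]
    rw [← one_mul (Matrix.det _), ← h3, mul_assoc, ← h2, Finset.mul_sum]
    refine Finset.sum_congr rfl fun τ _ => ?_
    rw [integral_const_mul,
      integral_fintype_prod_eq_prod (fun j t => f (τ (Sum.inl j)) t * g (σ j) t)]
    ring
  simp only [hσ]
  simp [Fintype.card_perm]

lemma exists_index {r : ℕ} (n : Fin r → ℕ) (a : Fin (∑ i, n i)) :
    ∃ (s : Fin r) (i : ℕ), i < n s ∧ (∑ t ∈ Finset.Iio s, n t) + i = a := by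
  obtain ⟨⟨s, i⟩, h⟩ := finSigmaFinEquiv.surjective a
  refine ⟨s, i, i.2, ?_⟩
  rw [← h, finSigmaFinEquiv_apply]
  congr 1
  symm
  apply Finset.sum_bij (fun (x : Fin (s : ℕ)) _ => Fin.castLE s.2.le x)
  · intro x _
    simp only [Finset.mem_Iio, Fin.lt_def]; exact x.2
  · intro x _ y _ hxy
    simpa using hxy
  · intro y hy
    simp only [Finset.mem_Iio, Fin.lt_def] at hy
    exact ⟨⟨y, hy⟩, Finset.mem_univ _, rfl⟩
  · intro x _; rfl

lemma andreief_plain {N : ℕ} (μ : Measure ℝ) [SigmaFinite μ]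
    (f : Fin N → ℝ → ℂ) (g : Fin N → ℝ → ℂ)
    (hint : ∀ k i, Integrable (fun x => f k x * g i x) μ) :
    ∫ x : Fin N → ℝ, (Matrix.of fun i j => f i (x j)).det *
      (Matrix.of fun i j => g i (x j)).det ∂(Measure.pi fun _ => μ) =
    (Nat.factorial N : ℂ) *
      (Matrix.of (fun j k => ∫ t, f k t * g j t ∂μ)).det := by
  have h := andreief (κ := Empty) μ (Sum.elim f (fun e => e.elim)) g (fun e => e.elim)
    (by rintro (k | k) i; exacts [hint k i, k.elim])
  have key : ∀ A : Fin N → Fin N ⊕ Empty → ℂ,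
      (Matrix.of (Sum.elim A (fun e : Empty => e.elim))).det =
        (Matrix.of fun i j => A i (Sum.inl j)).det := by
    intro A
    have : (Matrix.of (Sum.elim A (fun e : Empty => e.elim))) =
      Matrix.fromBlocks (Matrix.of fun i j => A i (Sum.inl j)) 0 0 0 := by
      ext (i | i) (j | j)
      · rfl
      · exact j.elim
      · exact i.elim
      · exact i.elim
    rw [this, Matrix.det_fromBlocks_zero₁₂]
    simp
  simp only [key, Sum.elim_inl] at h
  rw [← h]
  congr 1
  ext x
  congr 1
  rw [← Matrix.det_transpose]; rfl

lemma integrable_poly {E : Set ℝ} {v : ℝ → ℝ}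
    (h : ∀ k : ℕ, IntegrableOn (fun x => x ^ k * v x) E) (q : ℝ[X]) (i : ℕ) :
    Integrable (fun x => q.eval x * (x ^ i * v x)) (volume.restrict E) := by
  have : (fun x => q.eval x * (x ^ i * v x)) =
      fun x => ∑ k ∈ Finset.range (q.natDegree + 1), q.coeff k * (x ^ (k + i) * v x) := by
    ext x
    rw [eval_eq_sum_range, Finset.sum_mul]
    refine Finset.sum_congr rfl fun k _ => ?_
    ring
  rw [this]
  exact integrable_finsetSum _ fun k _ => (h (k + i)).const_mul _

/-- for a multiple orthogonal polynomial ensemble (AT ensemble) with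
multi-index `n`, `N = |n|` points, and a path `(n_0, …, n_{m-1})` of length `m` starting
at `n`, the `m`-th moment of the average characteristic polynomial at `z ∈ ℂ` equals
`(∏_{i<m} i!)⁻¹` times the Wronskian `det (P_{n_j}^{(i)}(z))_{i,j<m}`. -/
theorem moment_average_char_poly_eq_wronskian {r : ℕ} (hr : 1 ≤ r)
    (E : Set ℝ) (hE : E.OrdConnected) (hEm : MeasurableSet E)
    (w : Fin r → ℝ → ℝ) (hwc : ∀ j, ContinuousOn (w j) E)
    (hwi : ∀ (j : Fin r) (k : ℕ), IntegrableOn (fun x => x ^ k * w j x) E)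
    (hAT : ∀ n : Fin r → ℕ, IsATSystemFor E w n)
    (P : (Fin r → ℕ) → Polynomial ℝ) (hP : ∀ n, IsTypeII E w n (P n))
    (n : Fin r → ℕ)
    -- the functions `g_1, …, g_N` enumerating `x^i * w s x`, `i < n s`
    (g : Fin (∑ i, n i) → ℝ → ℝ)
    (hg : ∀ (s : Fin r) (i : ℕ) (hi : i < n s)
        (hlt : (∑ t ∈ Finset.Iio s, n t) + i < ∑ i, n i),
        g ⟨(∑ t ∈ Finset.Iio s, n t) + i, hlt⟩ = fun x => x ^ i * w s x)
    -- the normalizing constant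
    (Z : ℝ)
    (hZ : Z = ∫ x : Fin (∑ i, n i) → ℝ in (Set.univ.pi fun _ => E),
        Matrix.det (Matrix.of fun i j => x j ^ (i : ℕ)) *
        Matrix.det (Matrix.of fun i j => g i (x j)))
    (hZ0 : Z ≠ 0)
    (m : ℕ) (hm : 1 ≤ m) (p : Fin m → Fin r → ℕ) (hp : IsPath m n p) (z : ℂ) :
    (∫ x : Fin (∑ i, n i) → ℝ in (Set.univ.pi fun _ => E),
        (∏ k, (z - (x k : ℂ)) ^ m) *
          ((Matrix.det (Matrix.of fun i j => x j ^ (i : ℕ)) *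
            Matrix.det (Matrix.of fun i j => g i (x j)) : ℝ) : ℂ)) / (Z : ℂ) =
      (∏ i ∈ Finset.range m, (Nat.factorial i : ℂ))⁻¹ *
        Matrix.det (Matrix.of fun i j : Fin m =>
          Polynomial.aeval z (Polynomial.derivative^[(i : ℕ)] (P (p j)))) := by
  obtain ⟨hp0, hpd, hpm⟩ := hp
  have hnp : ∀ j i, n i ≤ p j i := by
    intro j i
    rw [← hp0 (by omega)]
    exact hpm _ _ (Fin.mk_le_of_le_val (Nat.zero_le _)) i
  have hgi : ∀ a, ∃ (s : Fin r) (i : ℕ), i < n s ∧ g a = fun x => x ^ i * w s x := by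
    intro a
    obtain ⟨s, i, hi, ha⟩ := exists_index n a
    refine ⟨s, i, hi, ?_⟩
    rw [← hg s i hi (by rw [ha]; exact a.2)]
    congr 1
    exact Fin.ext ha.symm
  clear hg
  generalize hN : ∑ i, n i = N at *
  have hint : ∀ (q : ℝ[X]) a, Integrable (fun x => q.eval x * g a x) (volume.restrict E) := by
    intro q a
    obtain ⟨s, i, hi, ha⟩ := hgi a
    rw [ha]
    exact integrable_poly (hwi s) q i
  have horth : ∀ j a, ∫ x in E, (P (p j)).eval x * g a x = 0 := by
    intro j a
    obtain ⟨s, i, hi, ha⟩ := hgi a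
    rw [ha, ← (hP (p j)).2.2 s i (lt_of_lt_of_le hi (hnp j s))]
    simp only [mul_assoc]
  set R : Fin N ⊕ Fin m → ℝ[X] := Sum.elim (fun k => X ^ (k : ℕ)) (fun j => P (p j)) with hR
  set Q : Fin m → ℂ[X] := fun j => (P (p j)).map (algebraMap ℝ ℂ) with hQ
  have hQd : ∀ j, (Q j).natDegree = N + j := by
    intro j
    rw [← hpd j, ← (hP (p j)).2.1]
    exact natDegree_map _
  have hQm : ∀ j, (Q j).Monic := fun j => (hP (p j)).1.map _
  have hev : ∀ (q : ℝ[X]) (t : ℝ),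
      (q.map (algebraMap ℝ ℂ)).eval (t : ℂ) = ((q.eval t : ℝ) : ℂ) := by
    intro q t
    rw [show (t : ℂ) = algebraMap ℝ ℂ t from rfl, eval_map_apply]; rfl
  have hintC : ∀ (q : ℝ[X]) a,
      Integrable (fun x : ℝ => ((q.eval x : ℝ) : ℂ) * ((g a x : ℝ) : ℂ)) (volume.restrict E) := by
    intro q a
    simpa using (hint q a).ofReal (𝕜 := ℂ)
  have hRQ : ∀ k, (R k).map (algebraMap ℝ ℂ) =
      Sum.elim (fun k : Fin N => (X ^ (k : ℕ) : ℂ[X])) Q k := by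
    rintro (k | k) <;> simp [R, Q]
  have hvol : (volume : Measure (Fin N → ℝ)).restrict (Set.univ.pi fun _ => E) =
      Measure.pi fun _ => volume.restrict E := by
    rw [volume_pi, Measure.restrict_pi_pi]
  set G : Matrix (Fin N) (Fin N) ℂ := Matrix.of fun j k =>
    ∫ t in E, ((((X ^ (k : ℕ) : ℝ[X]).eval t : ℝ) : ℂ)) * ((g j t : ℝ) : ℂ) with hG
  have hdetC : ∀ M : Matrix (Fin N) (Fin N) ℝ,
      ((M.det : ℝ) : ℂ) = (M.map (fun t : ℝ => (t : ℂ))).det := fun M =>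
    RingHom.map_det (algebraMap ℝ ℂ) M
  have hZC : (Z : ℂ) = (Nat.factorial N : ℂ) * G.det := by
    rw [hZ, ← integral_complex_ofReal, hvol, hG,
      ← andreief_plain (volume.restrict E) (fun k t => (((X ^ (k : ℕ) : ℝ[X]).eval t : ℝ) : ℂ))
        (fun j t => ((g j t : ℝ) : ℂ)) (fun k i => hintC _ _)]
    congr 1
    ext x
    rw [Complex.ofReal_mul, hdetC, hdetC]
    congr 2
    ext i j
    simp
  set W : Matrix (Fin m) (Fin m) ℂ := Matrix.of fun i j : Fin m =>
          Polynomial.aeval z (Polynomial.derivative^[(i : ℕ)] (P (p j))) with hW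
  set F : ℂ := ∏ i ∈ Finset.range m, (Nat.factorial i : ℂ) with hF
  have hF0 : F ≠ 0 := Finset.prod_ne_zero_iff.mpr fun i _ => by
    exact_mod_cast Nat.factorial_ne_zero i
  set B : Fin m → Fin N ⊕ Fin m → ℂ := fun l k =>
    (derivative^[(l : ℕ)] ((R k).map (algebraMap ℝ ℂ))).eval z with hB
  have hA := andreief (volume.restrict E) (fun k t => (((R k).eval t : ℝ) : ℂ))
    (fun j t => ((g j t : ℝ) : ℂ)) B (fun k i => hintC _ _)
  have hblock : (Matrix.of (Sum.elim (fun (j : Fin N) k =>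
      ∫ t in E, (((R k).eval t : ℝ) : ℂ) * ((g j t : ℝ) : ℂ)) B)).det = G.det * W.det := by
    have : (Matrix.of (Sum.elim (fun (j : Fin N) k =>
        ∫ t in E, (((R k).eval t : ℝ) : ℂ) * ((g j t : ℝ) : ℂ)) B)) =
        Matrix.fromBlocks G 0 (Matrix.of fun l k => B l (Sum.inl k)) W := by
      ext (i | i) (j | j)
      · rfl
      · simp only [Matrix.of_apply, Sum.elim_inl, Matrix.fromBlocks_apply₁₂, Matrix.zero_apply,
          hR, Sum.elim_inr]
        simp only [← Complex.ofReal_mul]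
        rw [integral_complex_ofReal, horth]; simp
      · rfl
      · simp only [Matrix.of_apply, Sum.elim_inr, Matrix.fromBlocks_apply₂₂, hW, hB, hR]
        rw [iterate_derivative_map, eval_map_algebraMap]
    rw [this, Matrix.det_fromBlocks_zero₁₂]
  have hintegrand : ∀ x : Fin N → ℝ, (∏ k, (z - (x k : ℂ)) ^ m) *
          ((Matrix.det (Matrix.of fun i j : Fin N => x j ^ (i : ℕ)) *
            Matrix.det (Matrix.of fun i j => g i (x j)) : ℝ) : ℂ) =
      F⁻¹ * ((Matrix.of (Sum.elim (fun j k => (((R k).eval (x j) : ℝ) : ℂ)) B)).det *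
        (Matrix.of fun i j => ((g i (x j) : ℝ) : ℂ)).det) := by
    intro x
    have hc := confluent (fun k => (x k : ℂ)) z Q hQd hQm
    have h1 : (Matrix.of (Sum.elim (fun j k => (((R k).eval (x j) : ℝ) : ℂ)) B)) =
        (Matrix.of fun i j => evF (m := m) (fun k => (x k : ℂ)) z i
          (Sum.elim (fun k : Fin N => (X ^ (k : ℕ) : ℂ[X])) Q j)) := by
      ext (i | i) j
      · simp only [Matrix.of_apply, Sum.elim_inl, evF_inl, ← hRQ, hev]
      · simp only [Matrix.of_apply, Sum.elim_inr, evF_inr, ← hRQ, hB]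
    rw [h1, hc, Complex.ofReal_mul, hdetC, hdetC]
    have h2 : (Matrix.of fun i j : Fin N => x j ^ (i : ℕ)).map (fun t : ℝ => (t : ℂ)) =
        Matrix.of fun i j : Fin N => (x j : ℂ) ^ (i : ℕ) := by
      ext i j; simp
    have h3 : (Matrix.of fun i j => g i (x j)).map (fun t : ℝ => (t : ℂ)) =
        Matrix.of fun i j => ((g i (x j) : ℝ) : ℂ) := by
      ext i j; simp
    rw [h2, h3, ← hF]
    field_simp
  have hZC0 : (Z : ℂ) ≠ 0 := by exact_mod_cast hZ0
  simp only [hintegrand]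
  rw [integral_const_mul, hvol, hA, hblock, ← mul_assoc (Nat.factorial N : ℂ), ← hZC]
  field_simp
end

section
/- Suppose the weights (w_1, …, w_r) form an AT system on [a,b] for every multi-index in ℕ^r (an AT ensemble), let n⃗ be a multi-index with N = |n⃗|, and assume the normalizing constant Z_N = ∫_{[a,b]^N} det(x_j^{i−1})_{i,j=1}^N det(g_i(x_j))_{i,j=1}^N dx_1⋯dx_N is nonzero. If m is an odd positive integer, then the function z ↦ E[ ∏_{k=1}^N (z − x_k)^m ], which is a polynomial in z, has exactly N real zeros, all of which are simple; here E[F] = (1/Z_N) ∫_{[a,b]^N} F(x_1,…,x_N) det(x_j^{i−1})_{i,j=1}^N det(g_i(x_j))_{i,j=1}^N dx_1⋯dx_N. -/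
open MeasureTheory Polynomial Finset

lemma simple_root_sign (p : ℝ[X]) (s : ℝ) (h0 : p.eval s = 0) (h1 : p.derivative.eval s ≠ 0) :
    ∀ᶠ e in nhdsWithin (0:ℝ) (Set.Ioi 0),
      0 < p.eval (s + e) * p.derivative.eval s ∧ p.eval (s - e) * p.derivative.eval s < 0 := by
  obtain ⟨q, hq⟩ := Polynomial.dvd_iff_isRoot.mpr h0
  have hd : p.derivative.eval s = q.eval s := by
    rw [hq]; simp
  have hc : ContinuousAt (fun e => q.eval (s + e) * q.eval s) 0 := by fun_prop
  have hc' : ContinuousAt (fun e => q.eval (s - e) * q.eval s) 0 := by fun_prop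
  rw [hd] at h1
  have hpos : 0 < q.eval s * q.eval s := mul_self_pos.mpr h1
  have e1 := hc.eventually (lt_mem_nhds (a := 0) (by simpa using hpos))
  have e2 := hc'.eventually (lt_mem_nhds (a := 0) (by simpa using hpos))
  filter_upwards [nhdsWithin_le_nhds e1, nhdsWithin_le_nhds e2, self_mem_nhdsWithin] with e h1 h2 he
  have he : 0 < e := he
  rw [hd]
  have a1 : p.eval (s + e) = e * q.eval (s + e) := by rw [hq]; simp
  have a2 : p.eval (s - e) = - e * q.eval (s - e) := by rw [hq]; simp
  rw [a1, a2]
  constructor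
  · nlinarith [mul_pos he h1]
  · nlinarith [mul_pos he h2]

lemma ivt_root (p : ℝ[X]) (a b : ℝ) (hab : a < b) (h : p.eval a * p.eval b < 0) :
    ∃ x, a < x ∧ x < b ∧ p.eval x = 0 := by
  rcases mul_neg_iff.mp h with ⟨h1, h2⟩ | ⟨h1, h2⟩
  · obtain ⟨x, hx, hx0⟩ := intermediate_value_Ioo' hab.le (f := fun x => p.eval x)
      (by fun_prop) ⟨h2, h1⟩
    exact ⟨x, hx.1, hx.2, hx0⟩
  · obtain ⟨x, hx, hx0⟩ := intermediate_value_Ioo hab.le (f := fun x => p.eval x)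
      (by fun_prop) ⟨h1, h2⟩
    exact ⟨x, hx.1, hx.2, hx0⟩

/-- counting of the roots below `z` near `z0` -/
lemma count_lt_right (S : Finset ℝ) (z0 : ℝ) :
    ∀ᶠ z in nhdsWithin z0 (Set.Ioi z0),
      (S.filter (· < z)).card = (S.filter (· < z0)).card + if z0 ∈ S then 1 else 0 := by
  have h : ∀ t ∈ S, ∀ᶠ z in nhdsWithin z0 (Set.Ioi z0), (t < z ↔ t ≤ z0) := by
    intro t _
    rcases le_or_gt t z0 with h | h
    · filter_upwards [self_mem_nhdsWithin] with z hz
      exact ⟨fun _ => h, fun _ => lt_of_le_of_lt h hz⟩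
    · filter_upwards [nhdsWithin_le_nhds (gt_mem_nhds h)] with z hz
      exact ⟨fun h' => absurd h' (not_lt.mpr hz.le), fun h' => absurd h (not_lt.mpr h')⟩
  filter_upwards [(Filter.eventually_all_finset S).mpr h] with z hz
  rw [Finset.filter_congr hz]
  split_ifs with hs
  · have : S.filter (· ≤ z0) = insert z0 (S.filter (· < z0)) := by
      ext t; simp only [mem_filter, mem_insert, le_iff_lt_or_eq]
      constructor
      · rintro ⟨a, b | b⟩ <;> tauto
      · rintro (rfl | ⟨a, b⟩) <;> tauto
    rw [this, Finset.card_insert_of_notMem (by simp)]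
  · congr 1
    apply Finset.filter_congr
    intro t ht
    exact ⟨fun h => lt_of_le_of_ne h (fun h' => hs (h' ▸ ht)), le_of_lt⟩

lemma count_lt_left (S : Finset ℝ) (z0 : ℝ) :
    ∀ᶠ z in nhdsWithin z0 (Set.Iio z0),
      (S.filter (· < z)).card = (S.filter (· < z0)).card := by
  have h : ∀ t ∈ S, ∀ᶠ z in nhdsWithin z0 (Set.Iio z0), (t < z ↔ t < z0) := by
    intro t _
    rcases lt_or_ge t z0 with h | h
    · filter_upwards [nhdsWithin_le_nhds (lt_mem_nhds h)] with z hz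
      exact ⟨fun _ => h, fun _ => hz⟩
    · filter_upwards [self_mem_nhdsWithin] with z hz
      have hz : z < z0 := hz
      constructor <;> intro <;> linarith
  filter_upwards [(Filter.eventually_all_finset S).mpr h] with z hz
  rw [Finset.filter_congr hz]

/-- If each root of a set `S0` is moved to a root in `S1`, signs are controlled. -/
lemma count_transfer (S0 S1 : Finset ℝ) (hcard : S0.card = S1.card) (ρ : ℝ → ℝ) (e : ℝ)
    (hsep : ∀ s ∈ S0, ∀ t ∈ S0, s ≠ t → 2 * e < |s - t|)
    (hρ : ∀ s ∈ S0, ρ s ∈ S1 ∧ |ρ s - s| < e) :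
    (S1.filter (· < 0)).card = (S0.filter (fun s => ρ s < 0)).card := by
  have hinj : Set.InjOn ρ S0 := by
    intro s hs t ht hst
    by_contra hne
    have h1 := hsep s hs t ht hne
    have h2 := abs_lt.mp (hρ s hs).2
    have h3 := abs_lt.mp (hρ t ht).2
    rw [hst] at h2
    have : |s - t| < 2 * e := abs_lt.mpr ⟨by linarith, by linarith⟩
    linarith
  have him : S0.image ρ = S1 := by
    apply Finset.eq_of_subset_of_card_le
    · intro x hx
      obtain ⟨s, hs, rfl⟩ := Finset.mem_image.mp hx
      exact (hρ s hs).1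
    · rw [Finset.card_image_of_injOn hinj, hcard]
  rw [← him, Finset.filter_image, Finset.card_image_of_injOn]
  exact hinj.mono (fun x hx => (Finset.mem_filter.mp hx).1)

theorem count_main (N : ℕ) (R : ℝ → ℝ[X]) (F : ℝ[X]) (m : ℝ) (hm : 0 < m)
    (S : ℝ → Finset ℝ) (c : ℝ → ℝ) (hc : ∀ z, c z ≠ 0) (hS : ∀ z, (S z).card = N)
    (hR : ∀ z, R z = C (c z) * ∏ t ∈ S z, (X - C t))
    (hcont : ∀ s, Continuous fun z => (R z).eval s)
    (hF : ∀ z, F.eval z = (R z).eval 0)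
    (hF' : ∀ z, F.derivative.eval z = m * (R z).derivative.eval 0)
    (hbot : ∃ z0, ∀ z ≤ z0, ∀ s ≤ 0, (R z).eval s ≠ 0)
    (htop : ∃ z0, ∀ z ≥ z0, ∀ s ≥ 0, (R z).eval s ≠ 0) :
    {z : ℝ | F.eval z = 0}.Finite ∧ {z : ℝ | F.eval z = 0}.ncard = N ∧
      ∀ z : ℝ, F.eval z = 0 → F.derivative.eval z ≠ 0 := by
  have hroot : ∀ z s, (R z).eval s = 0 ↔ s ∈ S z := by
    intro z s
    rw [hR]
    simp [eval_prod, Finset.prod_eq_zero_iff, hc, sub_eq_zero]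
  have hsimple : ∀ z s, (R z).eval s = 0 → (R z).derivative.eval s ≠ 0 := by
    intro z s hs
    have hs' := (hroot z s).mp hs
    rw [hR, ← Finset.mul_prod_erase _ _ hs']
    simp [hc, eval_prod, Finset.prod_eq_zero_iff, sub_eq_zero]
  have hFs : ∀ z : ℝ, F.eval z = 0 → F.derivative.eval z ≠ 0 := by
    intro z hz
    rw [hF'] 
    exact mul_ne_zero hm.ne' (hsimple z 0 (by rw [← hF, hz]))
  have hF0 : F ≠ 0 := by
    rintro rfl
    obtain ⟨z0, h⟩ := hbot
    exact h z0 le_rfl 0 le_rfl (by rw [← hF]; simp)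
  have hset : {z : ℝ | F.eval z = 0} = ↑F.roots.toFinset := by
    ext z; simp [hF0]
  have hmemF : ∀ z, z ∈ F.roots.toFinset ↔ F.eval z = 0 := by intro z; simp [hF0]
  rw [hset, Set.ncard_coe_finset]
  refine ⟨Finset.finite_toSet _, ?_, hFs⟩
  set K := F.roots.toFinset with hK
  let G : ℝ → ℤ := fun z => ((S z).filter (· < 0)).card - (K.filter (· < z)).card
  have hloc : IsLocallyConstant G := by
    rw [IsLocallyConstant.iff_eventually_eq]
    intro z0
    have hε : ∀ᶠ e in nhdsWithin (0:ℝ) (Set.Ioi 0),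
        0 < e ∧ (∀ s ∈ S z0, 0 < (R z0).eval (s + e) * (R z0).derivative.eval s ∧
          (R z0).eval (s - e) * (R z0).derivative.eval s < 0) ∧
        (∀ s ∈ S z0, ∀ t ∈ S z0, s ≠ t → 2 * e < |s - t|) ∧
        (∀ s ∈ S z0, s ≠ 0 → e < |s|) := by
      have small : ∀ d : ℝ, 0 < d → ∀ᶠ e in nhdsWithin (0:ℝ) (Set.Ioi 0), e < d :=
        fun d hd => nhdsWithin_le_nhds (gt_mem_nhds hd)
      refine Filter.Eventually.and self_mem_nhdsWithin (Filter.Eventually.and ?_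
        (Filter.Eventually.and ?_ ?_))
      · refine (Filter.eventually_all_finset _).mpr fun s hs => ?_
        have := (hroot z0 s).mpr hs
        exact simple_root_sign _ _ this (hsimple _ _ this)
      · refine (Filter.eventually_all_finset _).mpr fun s hs => ?_
        refine (Filter.eventually_all_finset _).mpr fun t ht => ?_
        by_cases hst : s = t
        · simp [hst]
        · filter_upwards [small (|s - t| / 2) (by have := abs_pos.mpr (sub_ne_zero.mpr hst); linarith)]
            with e he _
          linarith
      · refine (Filter.eventually_all_finset _).mpr fun s hs => ?_
        by_cases hst : s = 0
        · simp [hst]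
        · filter_upwards [small |s| (abs_pos.mpr hst)] with e he _
          exact he
    obtain ⟨e, he, hsg, hsep, hbig⟩ := hε.exists
    have hsg' : ∀ᶠ z in nhds z0, ∀ s ∈ S z0,
        0 < (R z).eval (s + e) * (R z0).derivative.eval s ∧
          (R z).eval (s - e) * (R z0).derivative.eval s < 0 := by
      refine (Filter.eventually_all_finset _).mpr fun s hs => ?_
      have c1 : Continuous fun z => (R z).eval (s + e) * (R z0).derivative.eval s :=
        (hcont _).mul continuous_const
      have c2 : Continuous fun z => (R z).eval (s - e) * (R z0).derivative.eval s :=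
        (hcont _).mul continuous_const
      exact (c1.continuousAt.eventually (lt_mem_nhds (hsg s hs).1)).and
        (c2.continuousAt.eventually (gt_mem_nhds (hsg s hs).2))
    -- general transfer
    have key : ∀ z, (∀ s ∈ S z0,
        0 < (R z).eval (s + e) * (R z0).derivative.eval s ∧
          (R z).eval (s - e) * (R z0).derivative.eval s < 0) → ∀ b : Prop, [Decidable b] →
        (0 ∈ S z0 → ∃ x, |x| < e ∧ (R z).eval x = 0 ∧ (x < 0 ↔ b)) →
        ((S z).filter (· < 0)).card = ((S z0).filter (· < 0)).card +
          if (0 ∈ S z0 ∧ b) then 1 else 0 := by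
      intro z hz b _ hb
      have hex : ∀ s : ℝ, ∃ x, s ∈ S z0 → x ∈ S z ∧ |x - s| < e ∧ (s = 0 → (x < 0 ↔ b)) := by
        intro s
        by_cases hs : s ∈ S z0
        · by_cases h0 : s = 0
          · subst h0
            obtain ⟨x, h1, h2, h3⟩ := hb hs
            exact ⟨x, fun _ => ⟨(hroot z x).mp h2, by simpa using h1, fun _ => h3⟩⟩
          · obtain ⟨h1, h2⟩ := hz s hs
            obtain ⟨x, hx1, hx2, hx3⟩ := ivt_root (R z) (s - e) (s + e) (by linarith) (by
              by_contra hcon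
              push Not at hcon
              have := mul_neg_of_neg_of_pos h2 h1
              nlinarith [mul_nonneg hcon (mul_self_nonneg ((R z0).derivative.eval s))])
            exact ⟨x, fun _ => ⟨(hroot z x).mp hx3, abs_lt.mpr ⟨by linarith, by linarith⟩,
              fun h => absurd h h0⟩⟩
        · exact ⟨0, fun h => absurd h hs⟩
      choose ρ hρ using hex
      rw [count_transfer (S z0) (S z) (by rw [hS, hS]) ρ e hsep
        (fun s hs => ⟨(hρ s hs).1, (hρ s hs).2.1⟩)]
      have hiff : ∀ s ∈ S z0, s ≠ 0 → (ρ s < 0 ↔ s < 0) := by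
        intro s hs h0
        have h1 := abs_lt.mp (hρ s hs).2.1
        have h2 := hbig s hs h0
        rcases lt_or_gt_of_ne h0 with h | h
        · rw [abs_of_neg h] at h2
          exact ⟨fun _ => h, fun _ => by linarith⟩
        · rw [abs_of_pos h] at h2
          constructor <;> intro <;> linarith
      split_ifs with hcase
      · obtain ⟨h0, hb1⟩ := hcase
        have : (S z0).filter (fun s => ρ s < 0) = insert 0 ((S z0).filter (· < 0)) := by
          ext t
          simp only [mem_filter, mem_insert]
          by_cases ht : t = 0
          · subst ht
            simp [h0, ((hρ 0 h0).2.2 rfl).mpr hb1]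
          · constructor
            · rintro ⟨a, b⟩; exact Or.inr ⟨a, (hiff t a ht).mp b⟩
            · rintro (a | ⟨a, b⟩)
              · exact absurd a ht
              · exact ⟨a, (hiff t a ht).mpr b⟩
        rw [this, Finset.card_insert_of_notMem (by simp)]
      · rw [add_zero]
        congr 1
        apply Finset.filter_congr
        intro t ht
        by_cases h0 : t = 0
        · subst h0
          have hnb : ¬ b := fun hb => hcase ⟨ht, hb⟩
          have := (hρ 0 ht).2.2 rfl
          simp [this, hnb]
        · exact hiff t ht h0
    have h0iff : 0 ∈ S z0 ↔ z0 ∈ K := by rw [← hroot, hmemF, hF]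
    -- sign of F near z0
    have hFsign : ∀ᶠ d in nhdsWithin (0:ℝ) (Set.Ioi 0), z0 ∈ K →
        0 < F.eval (z0 + d) * (R z0).derivative.eval 0 ∧
          F.eval (z0 - d) * (R z0).derivative.eval 0 < 0 := by
      by_cases hz : z0 ∈ K
      · have h1 := (hmemF z0).mp hz
        filter_upwards [simple_root_sign F z0 h1 (hFs z0 h1)] with d hd _
        rw [hF'] at hd
        constructor
        · by_contra hcon
          push Not at hcon
          nlinarith [mul_nonneg hm.le (neg_nonneg.mpr hcon)]
        · by_contra hcon
          push Not at hcon
          nlinarith [mul_nonneg hm.le hcon]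
      · exact Filter.Eventually.of_forall fun d h => absurd h hz
    have hright : ∀ᶠ z in nhdsWithin z0 (Set.Ioi z0), G z = G z0 := by
      have hFr : ∀ᶠ z in nhdsWithin z0 (Set.Ioi z0), z0 ∈ K →
          0 < F.eval z * (R z0).derivative.eval 0 := by
        have ht : Filter.Tendsto (fun z => z - z0) (nhdsWithin z0 (Set.Ioi z0))
            (nhdsWithin 0 (Set.Ioi 0)) := by
          apply tendsto_nhdsWithin_of_tendsto_nhds_of_eventually_within
          · have : ContinuousAt (fun z : ℝ => z - z0) z0 := by fun_prop
            have h := this.tendsto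
            simp only [sub_self] at h
            exact h.mono_left nhdsWithin_le_nhds
          · filter_upwards [self_mem_nhdsWithin] with z hz
            simpa using hz
        filter_upwards [ht.eventually hFsign] with z hz hk
        simpa using (hz hk).1
      filter_upwards [hFr, count_lt_right K z0, nhdsWithin_le_nhds hsg'] with z h1 h2 h3
      have := key z h3 True (by
        intro h0
        have hp := h1 (h0iff.mp h0)
        rw [hF] at hp
        have hq := (h3 0 h0).2
        rw [zero_sub] at hq
        obtain ⟨x, a, b, cx⟩ := ivt_root (R z) (-e) 0 (by linarith) (by
          by_contra hcon
          push Not at hcon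
          have := mul_neg_of_neg_of_pos hq hp
          nlinarith [mul_nonneg hcon (mul_self_nonneg ((R z0).derivative.eval 0))])
        exact ⟨x, abs_lt.mpr ⟨a, by linarith⟩, cx, by simpa using b⟩)
      simp only [and_true, h0iff] at this
      simp only [G, this, h2]
      push_cast
      ring
    have hleft : ∀ᶠ z in nhdsWithin z0 (Set.Iio z0), G z = G z0 := by
      have hFr : ∀ᶠ z in nhdsWithin z0 (Set.Iio z0), z0 ∈ K →
          F.eval z * (R z0).derivative.eval 0 < 0 := by
        have ht : Filter.Tendsto (fun z => z0 - z) (nhdsWithin z0 (Set.Iio z0))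
            (nhdsWithin 0 (Set.Ioi 0)) := by
          apply tendsto_nhdsWithin_of_tendsto_nhds_of_eventually_within
          · have : ContinuousAt (fun z : ℝ => z0 - z) z0 := by fun_prop
            have h := this.tendsto
            simp only [sub_self] at h
            exact h.mono_left nhdsWithin_le_nhds
          · filter_upwards [self_mem_nhdsWithin] with z hz
            simpa using hz
        filter_upwards [ht.eventually hFsign] with z hz hk
        simpa using (hz hk).2
      filter_upwards [hFr, count_lt_left K z0, nhdsWithin_le_nhds hsg'] with z h1 h2 h3
      have := key z h3 False (by
        intro h0
        have hp := h1 (h0iff.mp h0)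
        rw [hF] at hp
        have hq := (h3 0 h0).1
        rw [zero_add] at hq
        obtain ⟨x, a, b, cx⟩ := ivt_root (R z) 0 e (by linarith) (by
          by_contra hcon
          push Not at hcon
          have := mul_neg_of_neg_of_pos hp hq
          nlinarith [mul_nonneg hcon (mul_self_nonneg ((R z0).derivative.eval 0))])
        exact ⟨x, abs_lt.mpr ⟨by linarith, b⟩, cx, by simpa using a.le⟩)
      simp only [and_false, if_false, add_zero] at this
      simp only [G, this, h2]
    have : ∀ᶠ z in nhdsWithin z0 {z0}ᶜ, G z = G z0 := by
      rw [← Set.Iio_union_Ioi, nhdsWithin_union]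
      exact Filter.eventually_sup.mpr ⟨hleft, hright⟩
    rw [← nhdsNE_sup_pure]
    exact Filter.eventually_sup.mpr ⟨this, by simp⟩
  have hconst : ∀ x y, G x = G y := fun x y => hloc.apply_eq_of_preconnectedSpace x y
  obtain ⟨a, ha⟩ := hbot
  obtain ⟨b, hb⟩ := htop
  have hGa : G a = 0 := by
    have h1 : (S a).filter (· < 0) = ∅ := by
      apply Finset.filter_eq_empty_iff.mpr
      intro s hs hlt
      exact ha a le_rfl s hlt.le ((hroot a s).mpr hs)
    have h2 : K.filter (· < a) = ∅ := by
      apply Finset.filter_eq_empty_iff.mpr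
      intro s hs hlt
      exact ha s hlt.le 0 le_rfl (by rw [← hF]; exact (hmemF s).mp hs)
    simp [G, h1, h2]
  have hGb : G b = N - K.card := by
    have h1 : (S b).filter (· < 0) = S b := by
      apply Finset.filter_true_of_mem
      intro s hs
      by_contra hlt
      exact hb b le_rfl s (not_lt.mp hlt) ((hroot b s).mpr hs)
    have h2 : K.filter (· < b) = K := by
      apply Finset.filter_true_of_mem
      intro s hs
      by_contra hlt
      exact hb s (not_lt.mp hlt) 0 le_rfl (by rw [← hF]; exact (hmemF s).mp hs)
    simp [G, h1, h2, hS]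
  have := hconst a b
  rw [hGa, hGb] at this
  omega


lemma at_det_ne {r : ℕ} {E : Set ℝ} {w : Fin r → ℝ → ℝ} {n : Fin r → ℕ}
    (hAT : IsATSystemFor E w n) {M : ℕ} (e : Fin M ≃ (s : Fin r) × Fin (n s))
    (y : Fin M → ℝ) (hy : Function.Injective y) (hyE : ∀ j, y j ∈ E) :
    Matrix.det (Matrix.of fun i j => y j ^ ((e i).2 : ℕ) * w (e i).1 (y j)) ≠ 0 := by
  intro h0
  obtain ⟨c, hc, hc0⟩ := Matrix.exists_vecMul_eq_zero_iff.mpr h0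
  let q : Fin r → ℝ[X] := fun s => ∑ i : Fin (n s), C (c (e.symm ⟨s, i⟩)) * X ^ (i : ℕ)
  have hdeg : ∀ s, (q s).degree < (n s : WithBot ℕ) := by
    intro s
    apply (Polynomial.degree_sum_le _ _).trans_lt
    rw [Finset.sup_lt_iff (by exact WithBot.bot_lt_coe _)]
    intro i _
    apply (Polynomial.degree_C_mul_X_pow_le _ _).trans_lt
    exact_mod_cast i.2
  have hM : M = ∑ s, n s := by
    have := Fintype.card_congr e
    simpa using this
  have hne : ∃ s, q s ≠ 0 := by
    obtain ⟨k, hk⟩ := Function.ne_iff.mp hc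
    refine ⟨(e k).1, fun h => hk ?_⟩
    have := congrArg (fun p => p.coeff ((e k).2 : ℕ)) h
    simp only [q, finsetSum_coeff, coeff_C_mul, coeff_X_pow, coeff_zero] at this
    rw [Finset.sum_eq_single (e k).2] at this
    · simpa using this
    · intro b _ hb
      have : ((e k).2 : ℕ) ≠ b := fun h => hb (Fin.ext h.symm)
      simp [this]
    · simp
  obtain ⟨hfin, hcard⟩ := hAT q hdeg hne
  have hsub : Set.range y ⊆ {x ∈ E | ∑ j, (q j).eval x * w j x = 0} := by
    rintro _ ⟨j, rfl⟩
    refine ⟨hyE j, ?_⟩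
    have := congrFun hc0 j
    simp only [Matrix.vecMul, dotProduct, Matrix.of_apply, Pi.zero_apply] at this
    rw [← this]
    have h2 := Equiv.sum_comp e
      (fun p => c (e.symm p) * (y j ^ (p.2 : ℕ) * w p.1 (y j)))
    simp only [Equiv.symm_apply_apply] at h2
    rw [h2, Fintype.sum_sigma]
    apply Finset.sum_congr rfl
    intro s _
    simp only [q, eval_finsetSum, eval_mul, eval_C, eval_pow, eval_X]
    rw [Finset.sum_mul]
    apply Finset.sum_congr rfl
    intro i _
    ring
  have h1 := Set.ncard_le_ncard hsub hfin
  have h2 : (Set.range y).ncard = M := by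
    rw [← Set.image_univ, Set.ncard_image_of_injective _ hy]
    simp
  omega

/-- constant sign of the product of the two determinants -/
lemma det_const_sign {E : Set ℝ} (hE : E.OrdConnected) {M : ℕ} (f : Fin M → ℝ → ℝ)
    (hf : ∀ i, ContinuousOn (f i) E)
    (hne : ∀ y : Fin M → ℝ, Function.Injective y → (∀ j, y j ∈ E) →
      Matrix.det (Matrix.of fun i j => f i (y j)) ≠ 0) :
    ∃ σ : ℝ, σ ≠ 0 ∧ ∀ y : Fin M → ℝ, Function.Injective y → (∀ j, y j ∈ E) →
      0 < σ * (Matrix.det (Matrix.of fun i j : Fin M => y j ^ (i : ℕ)) *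
        Matrix.det (Matrix.of fun i j => f i (y j))) := by
  set H : (Fin M → ℝ) → ℝ := fun y => Matrix.det (Matrix.of fun i j : Fin M => y j ^ (i : ℕ)) *
        Matrix.det (Matrix.of fun i j => f i (y j)) with hH
  set U : Set (Fin M → ℝ) := {y | StrictMono y ∧ ∀ j, y j ∈ E} with hU
  have hconv : Convex ℝ U := by
    intro x hx y hy a b ha hb hab
    refine ⟨?_, ?_⟩
    · intro i j hij
      have h1 := hx.1 hij
      have h2 := hy.1 hij
      simp only [Pi.add_apply, Pi.smul_apply, smul_eq_mul]
      rcases ha.eq_or_lt with rfl | ha'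
      · have : b = 1 := by linarith
        subst this; linarith
      · nlinarith [mul_lt_mul_of_pos_left h1 ha', mul_le_mul_of_nonneg_left h2.le hb]
    · intro j
      exact (hE.convex) (hx.2 j) (hy.2 j) ha hb hab
  have hHc : ContinuousOn H U := by
    apply ContinuousOn.mul
    · apply Continuous.continuousOn
      apply Continuous.matrix_det
      fun_prop
    · have h1 : ∀ i j, ContinuousOn (fun y : Fin M → ℝ => f i (y j)) U := fun i j =>
        (hf i).comp (continuous_apply j).continuousOn (fun y hy => hy.2 j)
      simp only [Matrix.det_apply, Units.smul_def, zsmul_eq_mul, Matrix.of_apply]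
      exact continuousOn_finsetSum _ fun τ _ => continuousOn_const.mul
        (continuousOn_finsetProd _ fun i _ => h1 _ _)
  have hVne : ∀ y : Fin M → ℝ, Function.Injective y →
      Matrix.det (Matrix.of fun i j : Fin M => y j ^ (i : ℕ)) ≠ 0 := by
    intro y hy
    have := (Matrix.det_vandermonde_ne_zero_iff (v := y)).mpr hy
    rwa [← Matrix.det_transpose] at this
  have hsymm : ∀ (y : Fin M → ℝ) (τ : Equiv.Perm (Fin M)), H (y ∘ τ) = H y := by
    intro y τ
    have h1 := Matrix.det_permute' τ (Matrix.of fun i j : Fin M => y j ^ (i : ℕ))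
    have h2 := Matrix.det_permute' τ (Matrix.of fun i j : Fin M => f i (y j))
    have h3 : H (y ∘ τ) = ((Matrix.of fun i j : Fin M => y j ^ (i : ℕ)).submatrix id τ).det *
       ((Matrix.of fun i j : Fin M => f i (y j)).submatrix id τ).det := rfl
    rw [h3, h1, h2]
    have : ((Equiv.Perm.sign τ : ℤ) : ℝ) * ((Equiv.Perm.sign τ : ℤ) : ℝ) = 1 := by
      rw [← Int.cast_mul, ← Units.val_mul, Int.units_mul_self]; simp
    simp only [hH]
    linear_combination (Matrix.det (Matrix.of fun i j : Fin M => y j ^ (i : ℕ)) *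
        Matrix.det (Matrix.of fun i j => f i (y j))) * this
  have hHne : ∀ y ∈ U, H y ≠ 0 := fun y hy =>
    mul_ne_zero (hVne y hy.1.injective) (hne y hy.1.injective hy.2)
  have hsort : ∀ y : Fin M → ℝ, Function.Injective y → (∀ j, y j ∈ E) →
      y ∘ Tuple.sort y ∈ U := by
    intro y hy hyE
    exact ⟨(Tuple.monotone_sort y).strictMono_of_injective (hy.comp (Equiv.injective _)),
      fun j => hyE _⟩
  by_cases hem : U.Nonempty
  · obtain ⟨y0, hy0⟩ := hem
    refine ⟨H y0, hHne y0 hy0, ?_⟩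
    intro y hy hyE
    change 0 < H y0 * H y
    rw [← hsymm y (Tuple.sort y)]
    have h1 := hsort y hy hyE
    set y1 := y ∘ Tuple.sort y
    have hpre : (H '' U).OrdConnected := (hconv.isPreconnected.image H hHc).ordConnected
    by_contra hcon
    push Not at hcon
    have hne0 : H y0 * H y1 ≠ 0 := mul_ne_zero (hHne _ hy0) (hHne _ h1)
    have hneg : H y0 * H y1 < 0 := lt_of_le_of_ne hcon hne0
    have : (0:ℝ) ∈ H '' U := by
      rcases mul_neg_iff.mp hneg with ⟨a, b⟩ | ⟨a, b⟩
      · exact hpre.out ⟨y1, h1, rfl⟩ ⟨y0, hy0, rfl⟩ ⟨b.le, a.le⟩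
      · exact hpre.out ⟨y0, hy0, rfl⟩ ⟨y1, h1, rfl⟩ ⟨a.le, b.le⟩
    obtain ⟨y2, h2, h3⟩ := this
    exact hHne y2 h2 h3
  · refine ⟨1, one_ne_zero, ?_⟩
    intro y hy hyE
    exact absurd ⟨_, hsort y hy hyE⟩ hem

/-- sign-change set of a polynomial on an interval -/
lemma poly_sign_set {E : Set ℝ} (hE : E.OrdConnected) (d : ℕ) : ∀ q : ℝ[X], q ≠ 0 →
    q.natDegree ≤ d → ∃ (S : Finset ℝ) (σ : ℝ), σ ≠ 0 ∧ (∀ t ∈ S, t ∈ E) ∧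
      (∏ t ∈ S, (X - C t)) ∣ q ∧ ∀ x ∈ E, 0 ≤ σ * (q.eval x * ∏ t ∈ S, (x - t)) := by
  have base : ∀ q : ℝ[X], (∀ t ∈ E, q.eval t ≠ 0) →
      ∃ (S : Finset ℝ) (σ : ℝ), σ ≠ 0 ∧ (∀ t ∈ S, t ∈ E) ∧
      (∏ t ∈ S, (X - C t)) ∣ q ∧ ∀ x ∈ E, 0 ≤ σ * (q.eval x * ∏ t ∈ S, (x - t)) := by
    intro q hq
    by_cases hem : E.Nonempty
    · obtain ⟨x0, hx0⟩ := hem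
      refine ⟨∅, q.eval x0, hq x0 hx0, by simp, by simp, ?_⟩
      intro x hx
      simp only [Finset.prod_empty, mul_one]
      have hpre : ((fun x => q.eval x) '' E).OrdConnected :=
        (hE.isPreconnected.image _ (by fun_prop)).ordConnected
      by_contra hcon
      push Not at hcon
      have : (0:ℝ) ∈ (fun x => q.eval x) '' E := by
        rcases mul_neg_iff.mp hcon with ⟨a, b⟩ | ⟨a, b⟩
        · exact hpre.out ⟨x, hx, rfl⟩ ⟨x0, hx0, rfl⟩ ⟨b.le, a.le⟩
        · exact hpre.out ⟨x0, hx0, rfl⟩ ⟨x, hx, rfl⟩ ⟨a.le, b.le⟩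
      obtain ⟨t, ht, ht0⟩ := this
      exact hq t ht ht0
    · exact ⟨∅, 1, one_ne_zero, by simp, by simp, fun x hx => absurd ⟨x, hx⟩ hem⟩
  induction d with
  | zero =>
    intro q hq hd
    apply base
    intro t _ h0
    rw [Polynomial.eq_C_of_natDegree_le_zero hd] at h0 hq
    simp only [eval_C] at h0
    exact hq (by rw [h0]; simp)
  | succ d ih =>
    intro q hq hd
    by_cases hz : ∀ t ∈ E, q.eval t ≠ 0
    · exact base q hz
    push Not at hz
    obtain ⟨t, htE, ht0⟩ := hz
    obtain ⟨q1, hq1⟩ := Polynomial.dvd_iff_isRoot.mpr ht0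
    have hq10 : q1 ≠ 0 := by rintro rfl; simp [hq1] at hq
    have hd1 : q1.natDegree ≤ d := by
      have := congrArg natDegree hq1
      rw [natDegree_mul (X_sub_C_ne_zero t) hq10, natDegree_X_sub_C] at this
      omega
    obtain ⟨S, σ, hσ, hSE, hdvd, hs⟩ := ih q1 hq10 hd1
    by_cases htS : t ∈ S
    · refine ⟨S.erase t, σ, hσ, fun s hs => hSE s (Finset.mem_of_mem_erase hs), ?_, ?_⟩
      · rw [hq1]
        refine Dvd.dvd.mul_left ?_ _
        refine dvd_trans ?_ hdvd
        rw [← Finset.mul_prod_erase S _ htS]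
        exact Dvd.intro_left _ rfl
      · intro x hx
        have := hs x hx
        rw [← Finset.mul_prod_erase S _ htS] at this
        rw [hq1]
        simp only [eval_mul, eval_sub, eval_X, eval_C]
        convert this using 2
        ring
    · refine ⟨insert t S, σ, hσ, ?_, ?_, ?_⟩
      · intro s hs'
        rcases Finset.mem_insert.mp hs' with rfl | h
        · exact htE
        · exact hSE s h
      · rw [Finset.prod_insert htS, hq1]
        exact mul_dvd_mul_left _ hdvd
      · intro x hx
        have := mul_nonneg (hs x hx) (sq_nonneg (x - t))
        rw [Finset.prod_insert htS, hq1]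
        simp only [eval_mul, eval_sub, eval_X, eval_C]
        linarith

lemma exists_sub_index {r : ℕ} (K : ℕ) (d : ℕ) : ∀ (n : Fin r → ℕ), ∑ s, n s = K + d →
    ∃ n' : Fin r → ℕ, (∀ s, n' s ≤ n s) ∧ ∑ s, n' s = K := by
  induction d with
  | zero => intro n hn; exact ⟨n, fun _ => le_rfl, hn⟩
  | succ d ih =>
    intro n hn
    obtain ⟨s, _, hs⟩ : ∃ s ∈ Finset.univ, n s ≠ 0 := by
      apply Finset.exists_ne_zero_of_sum_ne_zero
      omega
    obtain ⟨n', h1, h2⟩ := ih (Function.update n s (n s - 1)) (by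
      rw [Finset.sum_update_of_mem (Finset.mem_univ s)]
      rw [← Finset.add_sum_erase _ _ (Finset.mem_univ s)] at hn
      rw [← Finset.erase_eq]
      omega)
    refine ⟨n', fun t => (h1 t).trans ?_, h2⟩
    by_cases h : t = s
    · subst h; simp
    · simp [h]

lemma vandermonde_cons {k : ℕ} (x : ℝ) (t : Fin k → ℝ) :
    Matrix.det (Matrix.of fun i j : Fin (k + 1) =>
      (Fin.cons x t : Fin (k + 1) → ℝ) j ^ (i : ℕ)) =
    (∏ j, (t j - x)) * Matrix.det (Matrix.vandermonde t) := by
  have : (Matrix.of fun i j : Fin (k + 1) => (Fin.cons x t : Fin (k + 1) → ℝ) j ^ (i : ℕ)) =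
    (Matrix.vandermonde (Fin.cons x t : Fin (k + 1) → ℝ)).transpose := rfl
  rw [this, Matrix.det_transpose, Matrix.det_vandermonde, Fin.prod_univ_succ]
  simp [Matrix.det_vandermonde, Fin.prod_Ioi_succ]


lemma int_poly_w {E : Set ℝ} {f : ℝ → ℝ}
    (hwi : ∀ k : ℕ, IntegrableOn (fun x => x ^ k * f x) E) (p : ℝ[X]) :
    IntegrableOn (fun x => p.eval x * f x) E := by
  have : (fun x => p.eval x * f x) =
      fun x => ∑ i ∈ Finset.range (p.natDegree + 1), p.coeff i * (x ^ i * f x) := by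
    ext x
    rw [Polynomial.eval_eq_sum_range, Finset.sum_mul]
    simp only [mul_assoc]
  rw [this]
  exact integrable_finsetSum _ fun i _ => (hwi i).const_mul _

lemma int_poly_w' {E : Set ℝ} {f : ℝ → ℝ}
    (hwi : ∀ k : ℕ, IntegrableOn (fun x => x ^ k * f x) E) (p : ℝ[X]) (i : ℕ) :
    IntegrableOn (fun x => p.eval x * (x ^ i * f x)) E := by
  have := int_poly_w hwi (p * X ^ i)
  simpa [mul_assoc] using this

lemma sign_changes {r : ℕ} {E : Set ℝ} (hE : E.OrdConnected) (hEm : MeasurableSet E)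
    (hE0 : volume E ≠ 0)
    {w : Fin r → ℝ → ℝ} (hwc : ∀ j, ContinuousOn (w j) E)
    (hwi : ∀ (j : Fin r) (k : ℕ), IntegrableOn (fun x => x ^ k * w j x) E)
    (hAT : ∀ n : Fin r → ℕ, IsATSystemFor E w n) (n : Fin r → ℕ)
    (q v : ℝ[X]) (hq : q ≠ 0) (hv : v ≠ 0) (hv0 : ∀ x, 0 ≤ v.eval x)
    (horth : ∀ s, ∀ i < n s, ∫ x in E, (q * v).eval x * (x ^ i * w s x) = 0) :
    ∃ S : Finset ℝ, ∑ s, n s ≤ S.card ∧ (∏ t ∈ S, (X - C t)) ∣ q := by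
  obtain ⟨S, σ, hσ, hSE, hdvd, hsgn⟩ := poly_sign_set hE q.natDegree q hq le_rfl
  refine ⟨S, ?_, hdvd⟩
  by_contra hlt
  push Not at hlt
  obtain ⟨k, hk⟩ : ∃ k, S.card = k := ⟨_, rfl⟩
  obtain ⟨n', hn', hsum⟩ := exists_sub_index (k + 1) (∑ s, n s - (k + 1)) n (by omega)
  have e : Fin (k + 1) ≃ (s : Fin r) × Fin (n' s) := Fintype.equivOfCardEq (by simp [hsum])
  let f : Fin (k + 1) → ℝ → ℝ := fun i x => x ^ ((e i).2 : ℕ) * w (e i).1 x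
  obtain ⟨τ, hτ, hdet⟩ := det_const_sign hE f
    (fun i => ContinuousOn.mul (by fun_prop) (hwc _)) (fun y hy hyE => at_det_ne (hAT n') e y hy hyE)
  let t : Fin k → ℝ := S.orderEmbOfFin hk
  have ht : Function.Injective t := (S.orderEmbOfFin hk).injective
  have htS : ∀ j, t j ∈ S := fun j => S.orderEmbOfFin_mem hk j
  have htprod : ∀ x, ∏ s ∈ S, (x - s) = ∏ j, (x - t j) := by
    intro x
    have : S = Finset.univ.image t := by
      symm
      apply Finset.eq_of_subset_of_card_le
      · intro y hy
        obtain ⟨j, _, rfl⟩ := Finset.mem_image.mp hy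
        exact htS j
      · rw [Finset.card_image_of_injective _ ht]; simp [hk]
    conv_lhs => rw [this]
    rw [Finset.prod_image (fun a _ b _ h => ht h)]
  let G : ℝ → ℝ := fun x => Matrix.det (Matrix.of fun i j =>
    f i ((Fin.cons x t : Fin (k + 1) → ℝ) j))
  let V := Matrix.det (Matrix.vandermonde t)
  have hG : ∀ x ∈ E, x ∉ S → 0 < (τ * V * (-1) ^ k) * ((∏ s ∈ S, (x - s)) * G x) := by
    intro x hx hxS
    have := hdet (Fin.cons x t) (by
      rw [Fin.cons_injective_iff]
      refine ⟨?_, ht⟩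
      rintro ⟨j, rfl⟩
      exact hxS (htS j)) (by
      intro j
      refine Fin.cases ?_ (fun j => ?_) j
      · exact hx
      · exact hSE _ (htS j))
    rw [vandermonde_cons] at this
    have h2 : ∏ j, (t j - x) = (-1) ^ k * ∏ s ∈ S, (x - s) := by
      rw [htprod]
      have : ∀ j, t j - x = (-1) * (x - t j) := fun j => by ring
      simp only [this, Finset.prod_mul_distrib]
      simp
    rw [h2] at this
    convert this using 1
    ring
  have hGexp : ∀ x, G x = ∑ i : Fin (k + 1), ((-1) ^ (i : ℕ) *
      Matrix.det (Matrix.of fun a b => f (i.succAbove a) (t b))) * f i x := by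
    intro x
    simp only [G]
    rw [Matrix.det_succ_column_zero]
    apply Finset.sum_congr rfl
    intro i _
    have : ((Matrix.of fun i j => f i ((Fin.cons x t : Fin (k + 1) → ℝ) j)).submatrix
        i.succAbove Fin.succ) = Matrix.of fun a b => f (i.succAbove a) (t b) := by
      ext a b; simp
    rw [this]
    simp only [Matrix.of_apply, Fin.cons_zero]
    ring
  have hint : ∀ i, IntegrableOn (fun x => (q * v).eval x * f i x) E := fun i =>
    int_poly_w' (hwi _) _ _
  have hqvG : ∀ x, (q * v).eval x * G x = ∑ i : Fin (k + 1), ((-1) ^ (i : ℕ) *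
      Matrix.det (Matrix.of fun a b => f (i.succAbove a) (t b))) * ((q * v).eval x * f i x) := by
    intro x
    rw [hGexp, Finset.mul_sum]
    exact Finset.sum_congr rfl fun i _ => by ring
  have hI : IntegrableOn (fun x => (q * v).eval x * G x) E := by
    simp only [hqvG]
    exact integrable_finsetSum _ fun i _ => (hint i).const_mul _
  have hI0 : ∫ x in E, (q * v).eval x * G x = 0 := by
    simp only [hqvG]
    rw [integral_finsetSum _ fun i _ => (hint i).const_mul _]
    apply Finset.sum_eq_zero
    intro i _
    rw [integral_const_mul, horth _ _ (lt_of_lt_of_le (e i).2.2 (hn' _)), mul_zero]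
  set a := σ * (τ * V * (-1) ^ k) with ha
  have hJ : IntegrableOn (fun x => a * ((q * v).eval x * G x)) E := hI.const_mul _
  have hJ0 : ∫ x in E, a * ((q * v).eval x * G x) = 0 := by
    rw [integral_const_mul, hI0, mul_zero]
  let B : Finset ℝ := S ∪ (q * v).roots.toFinset
  have hB : ∀ᵐ x ∂(volume.restrict E), x ∉ B := by
    apply ae_restrict_of_ae
    exact B.finite_toSet.measure_zero volume |> measure_eq_zero_iff_ae_notMem.mp
  have hEae : ∀ᵐ x ∂(volume.restrict E), x ∈ E := ae_restrict_mem hEm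
  have hpos : ∀ x ∈ E, x ∉ B → 0 < a * ((q * v).eval x * G x) := by
    intro x hx hxB
    have hxS : x ∉ S := fun h => hxB (Finset.mem_union_left _ h)
    have hxqv : (q * v).eval x ≠ 0 := fun h => hxB (Finset.mem_union_right _ (by
      simp only [Multiset.mem_toFinset, mem_roots (mul_ne_zero hq hv)]; exact h))
    rw [eval_mul] at hxqv ⊢
    have h1 := hG x hx hxS
    have h2 := hsgn x hx
    have hP : ∏ s ∈ S, (x - s) ≠ 0 := by
      rw [Finset.prod_ne_zero_iff]
      intro s hs h
      exact hxS (by rw [sub_eq_zero.mp h]; exact hs)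
    have h3 : 0 < σ * (q.eval x * ∏ t ∈ S, (x - t)) :=
      lt_of_le_of_ne h2 (Ne.symm (mul_ne_zero hσ (mul_ne_zero (left_ne_zero_of_mul hxqv) hP)))
    have h4 : 0 < v.eval x := lt_of_le_of_ne (hv0 x) (Ne.symm (right_ne_zero_of_mul hxqv))
    have h5 : 0 < (a * ((q.eval x * v.eval x) * G x)) * (∏ s ∈ S, (x - s)) ^ 2 := by
      have := mul_pos (mul_pos h3 h1) h4
      exact lt_of_lt_of_eq this (by rw [ha]; ring)
    exact pos_of_mul_pos_left h5 (sq_nonneg _)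
  have hnn : 0 ≤ᵐ[volume.restrict E] fun x => a * ((q * v).eval x * G x) := by
    filter_upwards [hB, hEae] with x h1 h2
    exact (hpos x h2 h1).le
  have := (integral_eq_zero_iff_of_nonneg_ae hnn hJ).mp hJ0
  have hF : ∀ᵐ x ∂(volume.restrict E), False := by
    filter_upwards [this, hB, hEae] with x h0 h1 h2
    have := hpos x h2 h1
    simp only [Pi.zero_apply] at h0
    linarith
  rw [Filter.eventually_false_iff_eq_bot, ae_eq_bot, Measure.restrict_eq_zero] at hF
  exact hE0 hF

lemma exists_typeII {r : ℕ} {E : Set ℝ} (hE : E.OrdConnected) (hEm : MeasurableSet E)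
    (hE0 : volume E ≠ 0)
    {w : Fin r → ℝ → ℝ} (hwc : ∀ j, ContinuousOn (w j) E)
    (hwi : ∀ (j : Fin r) (k : ℕ), IntegrableOn (fun x => x ^ k * w j x) E)
    (hAT : ∀ n : Fin r → ℕ, IsATSystemFor E w n) (n : Fin r → ℕ)
    (v : ℝ[X]) (hv : v ≠ 0) (hv0 : ∀ x, 0 ≤ v.eval x) :
    ∃ S : Finset ℝ, S.card = ∑ s, n s ∧
      ∀ s, ∀ i < n s, ∫ x in E, ((∏ t ∈ S, (X - C t)) * v).eval x * (x ^ i * w s x) = 0 := by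
  let L : degreeLT ℝ (∑ s, n s + 1) →ₗ[ℝ] (((s : Fin r) × Fin (n s)) → ℝ) :=
    { toFun := fun q p => ∫ x in E, ((q : ℝ[X]) * v).eval x * (x ^ (p.2 : ℕ) * w p.1 x)
      map_add' := by
        intro q1 q2
        ext p
        simp only [Pi.add_apply]
        rw [← integral_add (int_poly_w' (hwi _) _ _) (int_poly_w' (hwi _) _ _)]
        congr 1
        ext x
        simp; ring
      map_smul' := by
        intro c q
        ext p
        simp only [Pi.smul_apply, smul_eq_mul, RingHom.id_apply]
        rw [← integral_const_mul]
        congr 1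
        ext x
        simp; ring }
  have hker : LinearMap.ker L ≠ ⊥ := by
    apply LinearMap.ker_ne_bot_of_finrank_lt
    rw [(degreeLTEquiv ℝ (∑ s, n s + 1)).finrank_eq]
    simp
  obtain ⟨q, hqk, hq0⟩ := Submodule.exists_mem_ne_zero_of_ne_bot hker
  have hq0' : (q : ℝ[X]) ≠ 0 := fun h => hq0 (Subtype.ext h)
  have horth : ∀ s, ∀ i < n s, ∫ x in E, ((q : ℝ[X]) * v).eval x * (x ^ i * w s x) = 0 := by
    intro s i hi
    exact congrFun (LinearMap.mem_ker.mp hqk) ⟨s, ⟨i, hi⟩⟩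
  obtain ⟨S, hS, u, hu⟩ := sign_changes hE hEm hE0 hwc hwi hAT n q v hq0' hv hv0 horth
  have hu0 : u ≠ 0 := by rintro rfl; simp at hu; exact hq0 hu
  have hP0 : (∏ t ∈ S, (X - C t) : ℝ[X]) ≠ 0 := (monic_prod_X_sub_C _ _).ne_zero
  have hdeg := congrArg natDegree hu
  rw [natDegree_mul hP0 hu0, natDegree_finsetProd_X_sub_C_eq_card] at hdeg
  have hlt : (q : ℝ[X]).natDegree < ∑ s, n s + 1 := by
    rw [natDegree_lt_iff_degree_lt hq0']
    exact mem_degreeLT.mp q.2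
  have hu1 : u = C (u.coeff 0) := eq_C_of_natDegree_le_zero (by omega)
  have hc : u.coeff 0 ≠ 0 := by intro h; rw [h] at hu1; simp at hu1; exact hu0 hu1
  refine ⟨S, by omega, fun s i hi => ?_⟩
  have := horth s i hi
  rw [hu, hu1] at this
  have h2 : ∀ x, ((∏ t ∈ S, (X - C t)) * C (u.coeff 0) * v).eval x * (x ^ i * w s x) =
      u.coeff 0 * (((∏ t ∈ S, (X - C t)) * v).eval x * (x ^ i * w s x)) := by
    intro x; simp only [eval_mul, eval_C]; ring
  simp only [h2] at this
  rw [integral_const_mul] at this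
  exact (mul_eq_zero.mp this).resolve_left hc


lemma prod_det_det_expand {N : ℕ} (h f g : Fin N → ℝ → ℝ) (x : Fin N → ℝ) :
    (∏ k, h k (x k)) * (Matrix.det (Matrix.of fun i j => f i (x j)) *
      Matrix.det (Matrix.of fun i j => g i (x j))) =
    ∑ σ : Equiv.Perm (Fin N), ∑ τ : Equiv.Perm (Fin N),
      (((Equiv.Perm.sign σ : ℤ) : ℝ) * ((Equiv.Perm.sign τ : ℤ) : ℝ)) *
        ∏ k, (h k (x k) * (f (σ k) (x k) * g (τ k) (x k))) := by
  simp only [Matrix.det_apply', Matrix.of_apply]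
  rw [Finset.sum_mul_sum, Finset.mul_sum]
  apply Finset.sum_congr rfl
  intro σ _
  rw [Finset.mul_sum]
  apply Finset.sum_congr rfl
  intro τ _
  simp only [Finset.prod_mul_distrib]
  ring

lemma restrict_pi_E {N : ℕ} (E : Set ℝ) :
    (volume : Measure (Fin N → ℝ)).restrict (Set.univ.pi fun _ => E) =
      Measure.pi (fun _ : Fin N => (volume : Measure ℝ).restrict E) := by
  rw [volume_pi, Measure.restrict_pi_pi]

lemma prod_det_det_integrable {N : ℕ} {E : Set ℝ} (h f g : Fin N → ℝ → ℝ)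
    (hi : ∀ k i j, IntegrableOn (fun x => h k x * (f i x * g j x)) E) :
    IntegrableOn (fun x : Fin N → ℝ => (∏ k, h k (x k)) *
      (Matrix.det (Matrix.of fun i j => f i (x j)) *
      Matrix.det (Matrix.of fun i j => g i (x j)))) (Set.univ.pi fun _ => E) := by
  simp only [prod_det_det_expand]
  unfold IntegrableOn
  rw [restrict_pi_E]
  refine integrable_finsetSum _ fun σ _ => integrable_finsetSum _ fun τ _ => ?_
  apply Integrable.const_mul
  exact Integrable.fintype_prod
    (f := fun k x => h k x * (f (σ k) x * g (τ k) x)) (fun k => hi k (σ k) (τ k))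

lemma prod_det_det_zero {N : ℕ} {E : Set ℝ} (h : ℝ → ℝ) (f g : Fin N → ℝ → ℝ)
    (hi : ∀ i j, IntegrableOn (fun x => h x * (f i x * g j x)) E) (i0 : Fin N)
    (h0 : ∀ j, ∫ x in E, h x * (f i0 x * g j x) = 0) :
    ∫ x in (Set.univ.pi fun _ : Fin N => E), (∏ k, h (x k)) *
      (Matrix.det (Matrix.of fun i j => f i (x j)) *
      Matrix.det (Matrix.of fun i j => g i (x j))) = 0 := by
  simp only [prod_det_det_expand (fun _ => h)]
  rw [restrict_pi_E]
  have hint : ∀ σ τ : Equiv.Perm (Fin N), Integrable (fun x : Fin N → ℝ =>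
      (((Equiv.Perm.sign σ : ℤ) : ℝ) * ((Equiv.Perm.sign τ : ℤ) : ℝ)) *
        ∏ k, (h (x k) * (f (σ k) (x k) * g (τ k) (x k))))
      (Measure.pi (fun _ : Fin N => (volume : Measure ℝ).restrict E)) := by
    intro σ τ
    apply Integrable.const_mul
    exact Integrable.fintype_prod
      (f := fun k x => h x * (f (σ k) x * g (τ k) x)) (fun k => hi (σ k) (τ k))
  rw [integral_finsetSum _ fun σ _ => integrable_finsetSum _ fun τ _ => hint σ τ]
  apply Finset.sum_eq_zero
  intro σ _
  rw [integral_finsetSum _ fun τ _ => hint σ τ]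
  apply Finset.sum_eq_zero
  intro τ _
  rw [integral_const_mul,
    integral_fintype_prod_eq_prod (fun k x => h x * (f (σ k) x * g (τ k) x))]
  rw [Finset.prod_eq_zero (Finset.mem_univ (σ.symm i0)), mul_zero]
  simp only [Equiv.apply_symm_apply]
  exact h0 _

lemma avg_zero {N : ℕ} {E : Set ℝ} (g : Fin N → ℝ → ℝ)
    (hgi : ∀ (p : ℝ[X]) j, IntegrableOn (fun x => p.eval x * g j x) E)
    (S : Finset ℝ) (hS : S.card = N) (v : ℝ[X])
    (horth : ∀ j, ∫ x in E, ((∏ t ∈ S, (X - C t)) * v).eval x * g j x = 0)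
    (t : ℝ) (ht : t ∈ S) :
    ∫ x in (Set.univ.pi fun _ : Fin N => E), (∏ k, (v.eval (x k) * (t - x k))) *
      (Matrix.det (Matrix.of fun i j : Fin N => x j ^ (i : ℕ)) *
      Matrix.det (Matrix.of fun i j => g i (x j))) = 0 := by
  have hN : 0 < N := by rw [← hS]; exact Finset.card_pos.mpr ⟨t, ht⟩
  let i0 : Fin N := ⟨N - 1, by omega⟩
  let p : Fin N → ℝ[X] := fun i => if i = i0 then ∏ s ∈ S.erase t, (X - C s) else X ^ (i : ℕ)
  have hpd : ∀ i, (p i).natDegree = i := by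
    intro i
    simp only [p]
    split_ifs with h
    · rw [natDegree_finsetProd_X_sub_C_eq_card, Finset.card_erase_of_mem ht, h, hS]
    · simp
  have hpm : ∀ i, (p i).Monic := by
    intro i
    simp only [p]
    split_ifs with h
    · exact monic_prod_X_sub_C _ _
    · exact monic_X_pow _
  have hV : ∀ x : Fin N → ℝ, Matrix.det (Matrix.of fun i j : Fin N => x j ^ (i : ℕ)) =
      Matrix.det (Matrix.of fun i j : Fin N => (p i).eval (x j)) := by
    intro x
    have := Matrix.det_eval_matrixOfPolynomials_eq_det_vandermonde x p hpd hpm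
    rw [← Matrix.det_transpose, ← Matrix.det_transpose (Matrix.of _)] at this
    exact this
  simp only [hV]
  apply prod_det_det_zero (fun x => v.eval x * (t - x)) (fun i x => (p i).eval x) g _ i0
  · intro j
    have : ∀ x, v.eval x * (t - x) * ((p i0).eval x * g j x) =
        (-1) * (((∏ t ∈ S, (X - C t)) * v).eval x * g j x) := by
      intro x
      simp only [p, if_true]
      rw [← Finset.mul_prod_erase S _ ht]
      simp only [eval_mul, eval_sub, eval_X, eval_C]
      ring
    simp only [this]
    rw [integral_const_mul, horth, mul_zero]
  · intro i j
    have := hgi (v * (C t - X) * p i) j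
    simpa [mul_assoc] using this

lemma avg_ne_zero {N : ℕ} {E : Set ℝ} (hEm : MeasurableSet E) (g : Fin N → ℝ → ℝ)
    (hgi : ∀ (p : ℝ[X]) j, IntegrableOn (fun x => p.eval x * g j x) E)
    (σ : ℝ) (hσ : σ ≠ 0)
    (hsgn : ∀ y : Fin N → ℝ, Function.Injective y → (∀ j, y j ∈ E) →
      0 < σ * (Matrix.det (Matrix.of fun i j : Fin N => y j ^ (i : ℕ)) *
        Matrix.det (Matrix.of fun i j => g i (y j))))
    (hZ : ∫ x in (Set.univ.pi fun _ : Fin N => E),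
      (Matrix.det (Matrix.of fun i j : Fin N => x j ^ (i : ℕ)) *
      Matrix.det (Matrix.of fun i j => g i (x j))) ≠ 0)
    (v : ℝ[X]) (hv : v ≠ 0) (hv0 : ∀ x, 0 ≤ v.eval x) :
    ∫ x in (Set.univ.pi fun _ : Fin N => E), (∏ k, v.eval (x k)) *
      (Matrix.det (Matrix.of fun i j : Fin N => x j ^ (i : ℕ)) *
      Matrix.det (Matrix.of fun i j => g i (x j))) ≠ 0 := by
  intro h0
  apply hZ
  have hint := prod_det_det_integrable (E := E) (fun _ : Fin N => fun x => v.eval x)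
    (fun i x => x ^ (i : ℕ)) g (by
      intro k i j
      have := hgi (v * X ^ (i : ℕ)) j
      simpa [mul_assoc] using this)
  set D : (Fin N → ℝ) → ℝ := fun x =>
    (Matrix.det (Matrix.of fun i j : Fin N => x j ^ (i : ℕ)) *
      Matrix.det (Matrix.of fun i j => g i (x j))) with hD
  have hDnn : ∀ y : Fin N → ℝ, (∀ j, y j ∈ E) → 0 ≤ σ * D y := by
    intro y hy
    by_cases hinj : Function.Injective y
    · exact (hsgn y hinj hy).le
    · have : Matrix.det (Matrix.of fun i j : Fin N => y j ^ (i : ℕ)) = 0 := by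
        have h1 := (Matrix.det_vandermonde_ne_zero_iff (v := y)).not.mpr hinj
        rw [← Matrix.det_transpose] at h1
        exact not_not.mp h1
      simp [hD, this]
  have hmem : ∀ᵐ x ∂((volume : Measure (Fin N → ℝ)).restrict (Set.univ.pi fun _ => E)),
      ∀ j, x j ∈ E := by
    filter_upwards [ae_restrict_mem (MeasurableSet.univ_pi fun _ => hEm)] with x hx j
    exact hx j (Set.mem_univ j)
  have hae : ∀ᵐ x ∂((volume : Measure (Fin N → ℝ)).restrict (Set.univ.pi fun _ => E)),
      ∏ k, v.eval (x k) ≠ 0 := by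
    apply ae_restrict_of_ae
    have : ∀ k : Fin N, ∀ ρ ∈ v.roots.toFinset, ∀ᵐ x : Fin N → ℝ, x k ≠ ρ := by
      intro k ρ _
      rw [volume_pi]
      exact Measure.ae_eval_ne (fun _ : Fin N => (volume : Measure ℝ)) k ρ
    have h2 : ∀ᵐ x : Fin N → ℝ, ∀ k, ∀ ρ ∈ v.roots.toFinset, x k ≠ ρ := by
      rw [ae_all_iff]
      intro k
      exact (Filter.eventually_all_finset _).mpr (this k)
    filter_upwards [h2] with x hx
    rw [Finset.prod_ne_zero_iff]
    intro k _ hk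
    exact hx k (x k) (by simp only [Multiset.mem_toFinset, mem_roots hv]; exact hk) rfl
  have hnn : 0 ≤ᵐ[(volume : Measure (Fin N → ℝ)).restrict (Set.univ.pi fun _ => E)]
      fun x => σ * ((∏ k, v.eval (x k)) * D x) := by
    filter_upwards [hmem] with x hx
    have h1 := hDnn x hx
    have h2 : 0 ≤ ∏ k, v.eval (x k) := Finset.prod_nonneg fun k _ => hv0 _
    have := mul_nonneg h2 h1
    simp only [Pi.zero_apply]
    linarith
  have h1 := (integral_eq_zero_iff_of_nonneg_ae hnn (Integrable.const_mul hint σ)).mp (by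
    rw [integral_const_mul, h0, mul_zero])
  rw [integral_eq_zero_of_ae]
  filter_upwards [h1, hae] with x hx hx'
  simp only [Pi.zero_apply] at hx ⊢
  rcases mul_eq_zero.mp hx with h | h
  · exact absurd h hσ
  · exact (mul_eq_zero.mp h).resolve_left hx'


noncomputable def mapL {N : ℕ} (L : MvPolynomial (Fin N) ℝ →ₗ[ℝ] ℝ) :
    (MvPolynomial (Fin N) ℝ)[X] →ₗ[ℝ] ℝ[X] :=
  Polynomial.lsum fun i => (Polynomial.monomial i).comp L

lemma mapL_monomial {N : ℕ} (L : MvPolynomial (Fin N) ℝ →ₗ[ℝ] ℝ) (i : ℕ)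
    (a : MvPolynomial (Fin N) ℝ) : mapL L (monomial i a) = monomial i (L a) := by
  simp [mapL, Polynomial.lsum_apply, Polynomial.sum_monomial_index]

lemma mapL_coeff {N : ℕ} (L : MvPolynomial (Fin N) ℝ →ₗ[ℝ] ℝ)
    (p : (MvPolynomial (Fin N) ℝ)[X]) (i : ℕ) : (mapL L p).coeff i = L (p.coeff i) := by
  induction p using Polynomial.induction_on' with
  | add p q hp hq => simp [hp, hq]
  | monomial n a =>
    rw [mapL_monomial, coeff_monomial, coeff_monomial]
    split_ifs <;> simp

lemma mapL_eval {N : ℕ} (L : MvPolynomial (Fin N) ℝ →ₗ[ℝ] ℝ)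
    (p : (MvPolynomial (Fin N) ℝ)[X]) (z : ℝ) :
    (mapL L p).eval z = L (p.eval (MvPolynomial.C z)) := by
  induction p using Polynomial.induction_on' with
  | add p q hp hq => simp [hp, hq]
  | monomial n a =>
    rw [mapL_monomial, eval_monomial, eval_monomial, ← map_pow, mul_comm a,
      ← MvPolynomial.smul_eq_C_mul, map_smul, smul_eq_mul, mul_comm]

lemma mapL_derivative {N : ℕ} (L : MvPolynomial (Fin N) ℝ →ₗ[ℝ] ℝ)
    (p : (MvPolynomial (Fin N) ℝ)[X]) :
    (mapL L p).derivative = mapL L p.derivative := by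
  induction p using Polynomial.induction_on' with
  | add p q hp hq => simp [hp, hq]
  | monomial n a =>
    rw [mapL_monomial, derivative_monomial, derivative_monomial, mapL_monomial]
    congr 1
    have : a * (n : MvPolynomial (Fin N) ℝ) = (n : ℝ) • a := by
      rw [MvPolynomial.smul_eq_C_mul]; simp [mul_comm]
    rw [this, map_smul, smul_eq_mul, mul_comm]

/-- average of a product of powers, as a polynomial -/
noncomputable def avgT {N : ℕ} (L : MvPolynomial (Fin N) ℝ →ₗ[ℝ] ℝ) (e : Fin N → ℕ) : ℝ[X] :=
  mapL L (∏ k, (X - C (MvPolynomial.X k)) ^ e k)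

lemma avgT_eval {N : ℕ} (L : MvPolynomial (Fin N) ℝ →ₗ[ℝ] ℝ) (e : Fin N → ℕ) (z : ℝ) :
    (avgT L e).eval z = L (∏ k, (MvPolynomial.C z - MvPolynomial.X k) ^ e k) := by
  rw [avgT, mapL_eval]
  simp [eval_prod]

lemma avgT_coeff {N : ℕ} (L : MvPolynomial (Fin N) ℝ →ₗ[ℝ] ℝ) (hL : L 1 = 1) (e : Fin N → ℕ) :
    (avgT L e).natDegree = ∑ k, e k ∧ (avgT L e).Monic := by
  have hm : ∀ k ∈ Finset.univ, ((X - C (MvPolynomial.X k : MvPolynomial (Fin N) ℝ)) ^ e k).Monic :=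
    fun k _ => (monic_X_sub_C _).pow _
  have hmon : (∏ k, (X - C (MvPolynomial.X k : MvPolynomial (Fin N) ℝ)) ^ e k).Monic :=
    monic_prod_of_monic _ _ hm
  have hdeg : (∏ k, (X - C (MvPolynomial.X k : MvPolynomial (Fin N) ℝ)) ^ e k).natDegree =
      ∑ k, e k := by
    rw [natDegree_prod_of_monic _ _ hm]
    apply Finset.sum_congr rfl
    intro k _
    rw [(monic_X_sub_C _).natDegree_pow, natDegree_X_sub_C, mul_one]
  have h1 : (avgT L e).coeff (∑ k, e k) = 1 := by
    rw [avgT, mapL_coeff, ← hdeg, hmon.coeff_natDegree, hL]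
  have h2 : (avgT L e).natDegree = ∑ k, e k := by
    apply natDegree_eq_of_le_of_coeff_ne_zero
    · rw [natDegree_le_iff_coeff_eq_zero]
      intro i hi
      rw [avgT, mapL_coeff, coeff_eq_zero_of_natDegree_lt (by rw [hdeg]; exact hi), map_zero]
    · rw [h1]; exact one_ne_zero
  exact ⟨h2, by rw [Monic, leadingCoeff, h2, h1]⟩

lemma monic_eventually_pos (p : ℝ[X]) (hp : p.Monic) :
    ∀ᶠ z in Filter.atTop, 0 < p.eval z := by
  by_cases h : 0 < p.degree
  · exact (p.tendsto_atTop_of_leadingCoeff_nonneg h (by rw [hp.leadingCoeff]; norm_num)).eventually_gt_atTop 0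
  · have : p = 1 := hp.degree_le_zero_iff_eq_one.mp (not_lt.mp h)
    simp [this]

lemma monic_eventually_pos' (p : ℝ[X]) (hp : p.Monic) :
    ∀ᶠ z in Filter.atBot, 0 < (-1) ^ p.natDegree * p.eval z := by
  have hmon : (C ((-1 : ℝ) ^ p.natDegree) * p.comp (-X)).Monic := by
    rw [Monic, leadingCoeff_mul, leadingCoeff_C, leadingCoeff_comp (by simp), hp.leadingCoeff]
    rw [leadingCoeff_neg, leadingCoeff_X, one_mul, ← mul_pow]
    simp
  have := Filter.tendsto_neg_atBot_atTop.eventually (monic_eventually_pos _ hmon)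
  filter_upwards [this] with z hz
  simpa using hz

theorem from_functional (N : ℕ) (L : MvPolynomial (Fin N) ℝ →ₗ[ℝ] ℝ) (hL : L 1 = 1)
    (m : ℕ) (hm : 1 ≤ m)
    (hS : ∀ z : ℝ, ∃ S : Finset ℝ, S.card = N ∧ ∀ t ∈ S,
      L (∏ k, ((MvPolynomial.C z - MvPolynomial.X k) ^ (m - 1) *
        (MvPolynomial.C t - MvPolynomial.X k))) = 0)
    (hc : ∀ z : ℝ, L (∏ k, (MvPolynomial.C z - MvPolynomial.X k) ^ (m - 1)) ≠ 0) :
    {z : ℝ | (avgT L fun _ => m).eval z = 0}.Finite ∧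
    {z : ℝ | (avgT L fun _ => m).eval z = 0}.ncard = N ∧
      ∀ z : ℝ, (avgT L fun _ => m).eval z = 0 → (avgT L fun _ => m).derivative.eval z ≠ 0 := by
  let b : ℝ → Fin N → MvPolynomial (Fin N) ℝ := fun z k => MvPolynomial.C z - MvPolynomial.X k
  let PR : ℝ → (MvPolynomial (Fin N) ℝ)[X] := fun z =>
    ∏ k, (C (b z k ^ (m - 1)) * (X + C (b z k)))
  let R : ℝ → ℝ[X] := fun z => mapL L (PR z)
  let eA : Finset (Fin N) → Fin N → ℕ := fun A k => if k ∈ A then m - 1 else m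
  have hLs : ∀ (c : ℝ) (p : MvPolynomial (Fin N) ℝ), c * L p = L (MvPolynomial.C c * p) := by
    intro c p
    rw [← MvPolynomial.smul_eq_C_mul, map_smul, smul_eq_mul]
  have hmm : m - 1 + 1 = m := by omega
  have heA : ∀ A, ∑ k, eA A k + A.card = N * m := by
    intro A
    have : ∀ k, eA A k + (if k ∈ A then 1 else 0) = m := by
      intro k; simp only [eA]; split_ifs <;> omega
    have h2 := Finset.sum_congr rfl (fun k (_ : k ∈ (Finset.univ : Finset (Fin N))) => this k)
    rw [Finset.sum_add_distrib] at h2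
    simpa using h2
  have hReval : ∀ z s, (R z).eval s = L (∏ k, (b z k ^ (m - 1) * (MvPolynomial.C s + b z k))) := by
    intro z s
    simp only [R, PR, mapL_eval, eval_prod, eval_mul, eval_C, eval_add, eval_X]
  have hRexp : ∀ z s, (R z).eval s =
      ∑ A ∈ (Finset.univ : Finset (Fin N)).powerset, s ^ A.card * (avgT L (eA A)).eval z := by
    intro z s
    rw [hReval, Finset.prod_mul_distrib, Finset.prod_add, Finset.mul_sum, map_sum]
    apply Finset.sum_congr rfl
    intro A _
    rw [avgT_eval, hLs]
    congr 1
    have h1 : ∏ k, (MvPolynomial.C z - MvPolynomial.X k : MvPolynomial (Fin N) ℝ) ^ eA A k =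
        (∏ k, b z k ^ (m - 1)) * ∏ k ∈ Finset.univ \ A, b z k := by
      have : ∏ k ∈ Finset.univ \ A, b z k = ∏ k, if k ∈ A then 1 else b z k := by
        rw [Finset.prod_ite]
        simp only [Finset.prod_const_one, one_mul]
        apply Finset.prod_congr _ fun _ _ => rfl
        ext; simp
      rw [this, ← Finset.prod_mul_distrib]
      apply Finset.prod_congr rfl
      intro k _
      simp only [eA, b]
      split_ifs
      · simp
      · rw [← pow_succ, hmm]
    rw [h1]
    simp only [Finset.prod_const, map_pow]
    ring
  have hPRm : ∀ z, PR z = C (∏ k, b z k ^ (m - 1)) * ∏ k, (X + C (b z k)) := by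
    intro z; simp only [PR, Finset.prod_mul_distrib, map_prod]
  have hmonX : ∀ z, (∏ k, (X + C (b z k))).Monic :=
    fun z => monic_prod_of_monic _ _ fun k _ => monic_X_add_C _
  have hdegX : ∀ z, (∏ k, (X + C (b z k))).natDegree = N := by
    intro z
    rw [natDegree_prod_of_monic _ _ fun k _ => monic_X_add_C _]
    simp
  have hRN : ∀ z, (R z).coeff N = L (∏ k, b z k ^ (m - 1)) := by
    intro z
    have := (hmonX z).coeff_natDegree
    rw [hdegX] at this
    simp only [R, mapL_coeff, hPRm, coeff_C_mul, this, mul_one]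
  have hRbig : ∀ z i, N < i → (R z).coeff i = 0 := by
    intro z i hi
    simp only [R, mapL_coeff, hPRm, coeff_C_mul]
    rw [coeff_eq_zero_of_natDegree_lt (by rw [hdegX]; exact hi), mul_zero, map_zero]
  choose S0 hS0 hS0' using hS
  have hcard : ∀ z, ((S0 z).image (fun t => t - z)).card = N := by
    intro z
    rw [Finset.card_image_of_injective _ (sub_left_injective), hS0]
  apply count_main N R (avgT L fun _ => m) m (by exact_mod_cast hm)
    (fun z => (S0 z).image (fun t => t - z)) (fun z => L (∏ k, b z k ^ (m - 1))) hc hcard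
  · intro z
    apply Polynomial.eq_of_degree_sub_lt_of_eval_finset_eq ((S0 z).image (fun t => t - z))
    · rw [hcard, Polynomial.degree_lt_iff_coeff_zero]
      intro i hi
      have hmonS := monic_prod_X_sub_C (fun t : ℝ => t) ((S0 z).image (fun t => t - z))
      have hdegS := natDegree_finsetProd_X_sub_C_eq_card ((S0 z).image (fun t => t - z)) (fun t : ℝ => t)
      rw [hcard] at hdegS
      rw [coeff_sub, coeff_C_mul]
      rcases hi.eq_or_lt with rfl | hi
      · have := hmonS.coeff_natDegree
        rw [hdegS] at this
        rw [hRN, this, mul_one, sub_self]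
      · rw [hRbig z i hi, coeff_eq_zero_of_natDegree_lt (by rw [hdegS]; exact hi)]
        simp
    · intro x hx
      obtain ⟨t, ht, rfl⟩ := Finset.mem_image.mp hx
      rw [eval_mul, eval_prod, Finset.prod_eq_zero hx (by simp), mul_zero, hReval]
      rw [← hS0' z t ht]
      congr 1
      apply Finset.prod_congr rfl
      intro k _
      simp only [b, map_sub]
      ring
  · intro s
    simp only [hRexp]
    fun_prop
  · intro z
    rw [hReval, avgT_eval]
    congr 1
    apply Finset.prod_congr rfl
    intro k _
    simp only [b, map_zero, zero_add]
    rw [← pow_succ, hmm]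
  · intro z
    simp only [R, avgT]
    rw [mapL_derivative, mapL_derivative, mapL_eval, mapL_eval, hLs]
    congr 1
    simp only [PR, derivative_prod_finset, eval_finsetSum, Finset.mul_sum]
    apply Finset.sum_congr rfl
    intro k _
    simp only [eval_mul, eval_prod, derivative_X_sub_C_pow, derivative_mul, derivative_C,
      derivative_add, derivative_X, eval_add, eval_pow, eval_sub, eval_X, eval_C, b, map_zero,
      zero_add, ← pow_succ, hmm]
    simp
    ring
  · have hev : ∀ᶠ z in Filter.atBot, ∀ A ∈ (Finset.univ : Finset (Fin N)).powerset,
        0 < (-1) ^ (avgT L (eA A)).natDegree * (avgT L (eA A)).eval z :=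
      (Filter.eventually_all_finset _).mpr fun A _ => monic_eventually_pos' _ (avgT_coeff L hL _).2
    obtain ⟨z0, hz0⟩ := Filter.eventually_atBot.mp hev
    refine ⟨z0, fun z hz s hs => ?_⟩
    suffices h : 0 < (-1) ^ (N * m) * (R z).eval s by
      intro h0; rw [h0] at h; simp at h
    rw [hRexp, Finset.mul_sum]
    have hterm : ∀ A, (-1) ^ (N * m) * (s ^ A.card * (avgT L (eA A)).eval z) =
        (-s) ^ A.card * ((-1) ^ (avgT L (eA A)).natDegree * (avgT L (eA A)).eval z) := by
      intro A
      rw [(avgT_coeff L hL _).1, ← heA A, neg_pow s, pow_add]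
      ring
    apply Finset.sum_pos'
    · intro A hA
      rw [hterm]
      exact mul_nonneg (pow_nonneg (by linarith) _) (hz0 z hz A hA).le
    · refine ⟨∅, by simp, ?_⟩
      rw [hterm]
      simpa using hz0 z hz ∅ (by simp)
  · have hev : ∀ᶠ z in Filter.atTop, ∀ A ∈ (Finset.univ : Finset (Fin N)).powerset,
        0 < (avgT L (eA A)).eval z :=
      (Filter.eventually_all_finset _).mpr fun A _ => monic_eventually_pos _ (avgT_coeff L hL _).2
    obtain ⟨z0, hz0⟩ := Filter.eventually_atTop.mp hev
    refine ⟨z0, fun z hz s hs => ?_⟩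
    apply ne_of_gt
    rw [hRexp]
    apply Finset.sum_pos'
    · intro A hA
      exact mul_nonneg (pow_nonneg hs _) (hz0 z hz A hA).le
    · refine ⟨∅, by simp, ?_⟩
      simpa using hz0 z hz ∅ (by simp)

/-- for an AT ensemble with multi-index `n` and `N = |n|` points, if `m`
is odd then `z ↦ E[∏_k (z - x_k)^m]` is a polynomial in `z` with exactly `N` real
zeros, all of them simple. -/
theorem moment_average_char_poly_zeros_of_odd {r : ℕ} (hr : 1 ≤ r)
    (E : Set ℝ) (hE : E.OrdConnected) (hEm : MeasurableSet E)
    (w : Fin r → ℝ → ℝ) (hwc : ∀ j, ContinuousOn (w j) E)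
    (hwi : ∀ (j : Fin r) (k : ℕ), IntegrableOn (fun x => x ^ k * w j x) E)
    (hAT : ∀ n : Fin r → ℕ, IsATSystemFor E w n)
    (n : Fin r → ℕ)
    (g : Fin (∑ i, n i) → ℝ → ℝ)
    (hg : ∀ (s : Fin r) (i : ℕ) (hi : i < n s)
        (hlt : (∑ t ∈ Finset.Iio s, n t) + i < ∑ i, n i),
        g ⟨(∑ t ∈ Finset.Iio s, n t) + i, hlt⟩ = fun x => x ^ i * w s x)
    (Z : ℝ)
    (hZ : Z = ∫ x : Fin (∑ i, n i) → ℝ in (Set.univ.pi fun _ => E),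
        Matrix.det (Matrix.of fun i j => x j ^ (i : ℕ)) *
        Matrix.det (Matrix.of fun i j => g i (x j)))
    (hZ0 : Z ≠ 0)
    (m : ℕ) (hm : 1 ≤ m) (hmodd : Odd m) :
    ∃ Q : Polynomial ℝ,
      (∀ z : ℝ,
        (∫ x : Fin (∑ i, n i) → ℝ in (Set.univ.pi fun _ => E),
          (∏ k, (z - x k) ^ m) *
            (Matrix.det (Matrix.of fun i j => x j ^ (i : ℕ)) *
             Matrix.det (Matrix.of fun i j => g i (x j)))) / Z = Q.eval z) ∧
      {z : ℝ | Q.eval z = 0}.Finite ∧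
      {z : ℝ | Q.eval z = 0}.ncard = ∑ i, n i ∧
      ∀ z : ℝ, Q.eval z = 0 → Q.derivative.eval z ≠ 0 := by
  have hgE : ∀ p : (s : Fin r) × Fin (n s),
      g (finSigmaFinEquiv p) = fun x => x ^ (p.2 : ℕ) * w p.1 x := by
    intro p
    have hsum : ∑ t ∈ Finset.Iio p.1, n t = ∑ i : Fin (p.1 : ℕ), n (Fin.castLE p.1.2.le i) := by
      symm
      refine Finset.sum_bij (fun i _ => Fin.castLE p.1.2.le i) ?_ ?_ ?_ ?_
      · intro i _
        rw [Finset.mem_Iio, Fin.lt_def]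
        exact i.2
      · intro i _ j _ h
        exact Fin.castLE_injective _ h
      · intro t ht
        rw [Finset.mem_Iio, Fin.lt_def] at ht
        exact ⟨⟨t, ht⟩, Finset.mem_univ _, rfl⟩
      · intro i _; rfl
    have hval : (finSigmaFinEquiv p : ℕ) = ∑ t ∈ Finset.Iio p.1, n t + (p.2 : ℕ) := by
      rw [finSigmaFinEquiv_apply, hsum]
    have hlt : ∑ t ∈ Finset.Iio p.1, n t + (p.2 : ℕ) < ∑ i, n i := by
      rw [← hval]; exact (finSigmaFinEquiv p).2
    rw [← hg p.1 p.2 p.2.2 hlt]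
    congr 1
    exact Fin.ext hval
  let e : Fin (∑ i, n i) ≃ (s : Fin r) × Fin (n s) := finSigmaFinEquiv.symm
  have hge : ∀ j, g j = fun x => x ^ ((e j).2 : ℕ) * w (e j).1 x := by
    intro j
    rw [← hgE]
    simp [e]
  have hgi : ∀ (p : ℝ[X]) j, IntegrableOn (fun x => p.eval x * g j x) E := by
    intro p j
    rw [hge]
    exact int_poly_w' (hwi _) _ _
  obtain ⟨σ, hσ, hsgn⟩ := det_const_sign hE g
    (fun j => by rw [hge]; exact ContinuousOn.mul (by fun_prop) (hwc _))
    (fun y hy hyE => by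
      have := at_det_ne (hAT n) e y hy hyE
      simp only [hge]
      exact this)
  set D : (Fin (∑ i, n i) → ℝ) → ℝ := fun x => Matrix.det (Matrix.of fun i j : Fin (∑ i, n i) => x j ^ (i : ℕ)) *
        Matrix.det (Matrix.of fun i j => g i (x j)) with hD
  have hZD : Z = ∫ x in (Set.univ.pi fun _ : Fin (∑ i, n i) => E), D x := hZ
  have hDint : ∀ p : MvPolynomial (Fin (∑ i, n i)) ℝ, IntegrableOn (fun x => MvPolynomial.eval x p * D x)
      (Set.univ.pi fun _ => E) := by
    intro p
    simp only [MvPolynomial.eval_eq', Finset.sum_mul, mul_assoc]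
    refine integrable_finsetSum _ fun d _ => Integrable.const_mul ?_ _
    apply prod_det_det_integrable (fun k x => x ^ d k) (fun i x => x ^ (i : ℕ)) g
    intro k i j
    have := hgi (X ^ d k * X ^ (i : ℕ)) j
    simpa [mul_assoc] using this
  let L : MvPolynomial (Fin (∑ i, n i)) ℝ →ₗ[ℝ] ℝ :=
    { toFun := fun p => (∫ x in (Set.univ.pi fun _ : Fin (∑ i, n i) => E), MvPolynomial.eval x p * D x) / Z
      map_add' := by
        intro p q
        rw [← add_div, ← integral_add (hDint p) (hDint q)]
        simp only [map_add, add_mul]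
      map_smul' := by
        intro c p
        rw [RingHom.id_apply, smul_eq_mul, ← mul_div_assoc, ← integral_const_mul]
        simp only [MvPolynomial.smul_eval, mul_assoc] }
  have hLdef : ∀ p, L p = (∫ x in (Set.univ.pi fun _ : Fin (∑ i, n i) => E),
      MvPolynomial.eval x p * D x) / Z := fun p => rfl
  have hL1 : L 1 = 1 := by
    rw [hLdef]
    simp only [map_one, one_mul]
    rw [← hZD, div_self hZ0]
  have hv : ∀ z : ℝ, ((C z - X) ^ (m - 1) : ℝ[X]) ≠ 0 := by
    intro z
    apply pow_ne_zero
    intro h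
    have := congrArg (fun p => p.coeff 1) h
    simp at this
  have hv0 : ∀ z x : ℝ, 0 ≤ ((C z - X) ^ (m - 1) : ℝ[X]).eval x := by
    intro z x
    simp only [eval_pow]
    exact (Nat.Odd.sub_odd hmodd odd_one).pow_nonneg _
  obtain ⟨h1, h2, h3⟩ := from_functional (∑ i, n i) L hL1 m hm (by
    intro z
    by_cases hN0 : (∑ i, n i) = 0
    · exact ⟨∅, by simp [hN0], by simp⟩
    have hE0 : volume E ≠ 0 := by
      intro h
      apply hZ0
      rw [hZD]
      have : (volume : Measure (Fin (∑ i, n i) → ℝ)) (Set.univ.pi fun _ => E) = 0 := by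
        rw [volume_pi, Measure.pi_pi]
        simp [h, hN0]
      rw [Measure.restrict_eq_zero.mpr this, integral_zero_measure]
    obtain ⟨S, hS, horth⟩ := exists_typeII hE hEm hE0 hwc hwi hAT n _ (hv z) (hv0 z)
    refine ⟨S, hS, fun t ht => ?_⟩
    have := avg_zero g hgi S hS ((C z - X) ^ (m - 1)) (by
      intro j
      rw [hge]
      exact horth _ _ (e j).2.2) t ht
    rw [hLdef, div_eq_zero_iff]
    left
    rw [← this]
    simp [hD, map_prod]) (by
    intro z
    have := avg_ne_zero hEm g hgi σ hσ hsgn (by rw [← hZ]; exact hZ0) _ (hv z) (hv0 z)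
    rw [hLdef]
    refine div_ne_zero ?_ hZ0
    convert this using 3
    simp [hD, map_prod])
  refine ⟨avgT L fun _ => m, ?_, h1, h2, h3⟩
  intro z
  rw [avgT_eval, hLdef]
  simp [hD, map_prod]
end

section
/- The multiple Hermite polynomials satisfy the Turán-type inequality H_{n⃗+e⃗_j}(x) · H_{n⃗+e⃗_k}(x) − H_{n⃗}(x) · H_{n⃗+e⃗_j+e⃗_k}(x) > 0 for all x ∈ ℝ, for every multi-index n⃗ ∈ ℕ^r and all j, k ∈ {1, …, r}. -/
open MeasureTheory Polynomial Finset

/-- `P` is the multiple Hermite polynomial for the (pairwise distinct) parameters `c`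
and the multi-index `n`: it is monic of degree `|n|` and satisfies
`∫ x^k P(x) exp(-x² + c j x) dx = 0` for all `k < n j` and all `j`. -/
def IsMultipleHermite {r : ℕ} (c : Fin r → ℝ) (n : Fin r → ℕ)
    (P : Polynomial ℝ) : Prop :=
  P.Monic ∧ P.natDegree = ∑ i, n i ∧
    ∀ j : Fin r, ∀ k < n j,
      ∫ x : ℝ, x ^ k * P.eval x * Real.exp (-x ^ 2 + c j * x) = 0

/-- The `j`-th standard unit multi-index `e⃗_j` in `ℕ^r`. -/
def unitMI {r : ℕ} (j : Fin r) : Fin r → ℕ := fun i => if i = j then 1 else 0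

/-- The raising operator. -/
noncomputable def raiseOp (a : ℝ) (p : ℝ[X]) : ℝ[X] :=
  (X - C (a / 2)) * p - C (1 / 2) * derivative p

/-- Laguerre inequality for products of real linear factors. -/
lemma laguerre_prod (s : Multiset ℝ) (x : ℝ) :
    0 ≤ (derivative (s.map (fun a => X - C a)).prod).eval x ^ 2 -
      ((s.map (fun a => X - C a)).prod).eval x *
      (derivative (derivative (s.map (fun a => X - C a)).prod)).eval x := by
  induction s using Multiset.induction_on with
  | empty => simp
  | cons a s ih =>
    simp only [Multiset.map_cons, Multiset.prod_cons]
    generalize (s.map (fun a => X - C a)).prod = R at ih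
    simp only [derivative_mul, derivative_sub, derivative_X, derivative_C, sub_zero, one_mul,
      derivative_add, eval_add, eval_mul, eval_sub, eval_X, eval_C]
    nlinarith [sq_nonneg (R.eval x), mul_nonneg (sq_nonneg (x - a)) ih]

lemma laguerre_splits {P : ℝ[X]} (hP : P.Splits) (hm : P.Monic) (x : ℝ) :
    0 ≤ (derivative P).eval x ^ 2 - P.eval x * (derivative (derivative P)).eval x := by
  rw [hP.eq_prod_roots_of_monic hm]
  exact laguerre_prod _ x

lemma im_prod (s : Multiset ℝ) (z : ℂ) :
    (aeval z (derivative (s.map (fun a => X - C a)).prod) *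
      (starRingEnd ℂ) (aeval z (s.map (fun a => X - C a)).prod)).im * z.im ≤ 0 := by
  induction s using Multiset.induction_on with
  | empty => simp
  | cons a s ih =>
    simp only [Multiset.map_cons, Multiset.prod_cons]
    generalize (s.map (fun a => X - C a)).prod = R at ih
    simp only [derivative_mul, derivative_sub, derivative_X, derivative_C, sub_zero, one_mul,
      map_add, map_mul, map_sub, aeval_X, aeval_C]
    generalize aeval z R = u at *
    generalize aeval z (derivative R) = v at *
    simp only [Complex.mul_im, Complex.mul_re, Complex.add_re, Complex.add_im, Complex.sub_re,
      Complex.sub_im, Complex.conj_re, Complex.conj_im, Complex.coe_algebraMap,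
      Complex.ofReal_re, Complex.ofReal_im] at *
    nlinarith [mul_nonneg (sq_nonneg z.im) (add_nonneg (sq_nonneg u.re) (sq_nonneg u.im)),
      mul_nonneg (add_nonneg (sq_nonneg (z.re - a)) (sq_nonneg z.im)) (neg_nonneg.2 ih)]

lemma raise_splits {P : ℝ[X]} (hP : P.Splits) (hm : P.Monic) (a : ℝ)
    (hQ : (raiseOp a P).Monic) : (raiseOp a P).Splits := by
  refine Splits.of_splits_map (algebraMap ℝ ℂ) (IsAlgClosed.splits _) ?_
  intro z hz
  have hz0 : aeval z (raiseOp a P) = 0 := by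
    have := isRoot_of_mem_roots hz
    rwa [IsRoot, eval_map_algebraMap] at this
  by_cases hP0 : aeval z P = 0
  · refine hP.mem_range_of_isRoot hm.ne_zero (i := algebraMap ℝ ℂ) ?_
    rwa [IsRoot, eval_map_algebraMap]
  have h1 : (aeval z (derivative P) * (starRingEnd ℂ) (aeval z P)).im * z.im ≤ 0 := by
    rw [hP.eq_prod_roots_of_monic hm]
    exact im_prod _ z
  have hv : aeval z (derivative P) = (2 * z - a) * aeval z P := by
    simp only [raiseOp, map_sub, map_mul, aeval_X, aeval_C, Complex.coe_algebraMap] at hz0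
    push_cast at hz0
    linear_combination (-2) * hz0
  rw [hv, mul_assoc, Complex.mul_conj] at h1
  have h2 : 0 < Complex.normSq (aeval z P) := Complex.normSq_pos.2 hP0
  have h3 : z.im = 0 := by
    simp at h1
    by_contra h
    have : 0 < z.im ^ 2 := by positivity
    nlinarith [mul_pos this h2]
  exact ⟨z.re, by apply Complex.ext <;> simp [h3]⟩

/-- Positivity of the Wronskian-like expression. -/
lemma wr_pos {P : ℝ[X]} (hP : P.Splits) (hm : P.Monic)
    (hs : ∀ x, P.eval x = 0 → (derivative P).eval x ≠ 0) (x : ℝ) :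
    0 < P.eval x ^ 2 + ((derivative P).eval x ^ 2 -
      P.eval x * (derivative (derivative P)).eval x) / 2 := by
  have h := laguerre_splits hP hm x
  by_cases h0 : P.eval x = 0
  · have := hs x h0
    rw [h0]
    have : 0 < (derivative P).eval x ^ 2 := by positivity
    linarith
  · have : 0 < P.eval x ^ 2 := by positivity
    linarith

lemma raise_simple {P : ℝ[X]} (hP : P.Splits) (hm : P.Monic)
    (hs : ∀ x, P.eval x = 0 → (derivative P).eval x ≠ 0) (a x : ℝ)
    (h0 : (raiseOp a P).eval x = 0) : (derivative (raiseOp a P)).eval x ≠ 0 := by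
  intro h1
  have h := wr_pos hP hm hs x
  simp [raiseOp] at h0 h1
  have h2 : P.eval x ^ 2 + ((derivative P).eval x ^ 2 -
      P.eval x * (derivative (derivative P)).eval x) / 2 = 0 := by
    linear_combination P.eval x * h1 - (derivative P).eval x * h0
  linarith

/-- The weighted integral. -/
noncomputable def wInt (a : ℝ) (p : ℝ[X]) : ℝ :=
  ∫ x : ℝ, p.eval x * Real.exp (-x ^ 2 + a * x)

lemma integrable_gauss (p : ℝ[X]) :
    Integrable (fun x : ℝ => p.eval x * Real.exp (-x ^ 2)) := by
  induction p using Polynomial.induction_on' with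
  | add p q hp hq =>
    refine (hp.add hq).congr (Filter.Eventually.of_forall fun x => ?_)
    simp [add_mul]
  | monomial n b =>
    have h := (integrable_rpow_mul_exp_neg_mul_sq (b := 1) one_pos (s := n)
      (by have : (0:ℝ) ≤ n := n.cast_nonneg
          linarith)).const_mul b
    simpa [mul_assoc] using h

lemma integrable_w (a : ℝ) (p : ℝ[X]) :
    Integrable (fun x : ℝ => p.eval x * Real.exp (-x ^ 2 + a * x)) := by
  have h := ((integrable_gauss (p.comp (X + C (a / 2)))).comp_sub_right (a / 2)).const_mul
    (Real.exp (a ^ 2 / 4))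
  refine h.congr (Filter.Eventually.of_forall fun x => ?_)
  have : Real.exp (-x ^ 2 + a * x) = Real.exp (a ^ 2 / 4) * Real.exp (-(x - a / 2) ^ 2) := by
    rw [← Real.exp_add]
    congr 1
    ring
  simp only [this, eval_comp, eval_add, eval_X, eval_C, sub_add_cancel]
  ring

lemma wInt_add (a : ℝ) (p q : ℝ[X]) : wInt a (p + q) = wInt a p + wInt a q := by
  unfold wInt
  rw [← integral_add (integrable_w a p) (integrable_w a q)]
  simp [add_mul]

lemma wInt_C_mul (a b : ℝ) (p : ℝ[X]) : wInt a (C b * p) = b * wInt a p := by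
  unfold wInt
  rw [← integral_const_mul]
  simp [mul_assoc]

lemma wInt_sub (a : ℝ) (p q : ℝ[X]) : wInt a (p - q) = wInt a p - wInt a q := by
  have h : p - q = p + C (-1) * q := by simp [sub_eq_add_neg]
  rw [h, wInt_add, wInt_C_mul]
  ring

lemma wInt_deriv (a : ℝ) (p : ℝ[X]) :
    wInt a (derivative p + (C a - C 2 * X) * p) = 0 := by
  unfold wInt
  refine integral_eq_zero_of_hasDerivAt_of_integrable
    (f := fun x : ℝ => p.eval x * Real.exp (-x ^ 2 + a * x)) (fun x => ?_)
    (integrable_w a _) (integrable_w a p)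
  have h1 : HasDerivAt (fun x : ℝ => -x ^ 2 + a * x) (-(2 * x) + a) x := by
    have := ((hasDerivAt_pow 2 x).neg).add ((hasDerivAt_id x).const_mul a)
    exact this.congr_deriv (by norm_num)
  refine ((p.hasDerivAt x).mul h1.exp).congr_deriv ?_
  simp only [eval_add, eval_mul, eval_sub, eval_C, eval_X]
  ring

/-- Integration by parts for the raising operator. -/
lemma wInt_raise (a : ℝ) (q p : ℝ[X]) :
    wInt a (q * raiseOp a p) = 1 / 2 * wInt a (derivative q * p) := by
  have h := wInt_deriv a (q * p)
  have e : q * raiseOp a p = C (1 / 2) * (derivative q * p)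
      - C (1 / 2) * (derivative (q * p) + (C a - C 2 * X) * (q * p)) := by
    have h2 : (C (1 / 2) * C 2 : ℝ[X]) = 1 := by rw [← C_mul]; norm_num
    have h3 : (C (a / 2) : ℝ[X]) = C (1 / 2) * C a := by rw [← C_mul]; congr 1; ring
    rw [raiseOp, derivative_mul, h3]
    linear_combination (- X * q * p) * h2
  rw [e, wInt_sub, wInt_C_mul, wInt_C_mul, h]
  ring

lemma raise_change (a b : ℝ) (p : ℝ[X]) :
    raiseOp b p = raiseOp a p + C ((a - b) / 2) * p := by
  have : (C ((a - b) / 2) : ℝ[X]) = C (a / 2) - C (b / 2) := by rw [← C_sub]; congr 1; ring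
  rw [raiseOp, raiseOp, this]
  ring

lemma wInt_raise_pow (a b : ℝ) (k : ℕ) (p : ℝ[X]) :
    wInt a (X ^ k * raiseOp b p) =
      k / 2 * wInt a (X ^ (k - 1) * p) + (a - b) / 2 * wInt a (X ^ k * p) := by
  have e : X ^ k * raiseOp b p = X ^ k * raiseOp a p + C ((a - b) / 2) * (X ^ k * p) := by
    rw [raise_change a b]
    ring
  have e2 : derivative (X ^ k : ℝ[X]) * p = C (k : ℝ) * (X ^ (k - 1) * p) := by
    rw [derivative_X_pow]
    ring
  rw [e, wInt_add, wInt_raise, wInt_C_mul, e2, wInt_C_mul]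
  ring

lemma wInt_one_pos (a : ℝ) : 0 < wInt a 1 := by
  have h := integrable_w a 1
  simp only [eval_one, one_mul] at h
  simpa [wInt] using integral_exp_pos h

lemma raise_monic {P : ℝ[X]} (hm : P.Monic) (a : ℝ) :
    (raiseOp a P).Monic ∧ (raiseOp a P).natDegree = P.natDegree + 1 := by
  have h1 : ((X - C (a / 2)) * P).Monic := (monic_X_sub_C _).mul hm
  have h2 : ((X - C (a / 2)) * P).natDegree = P.natDegree + 1 := by
    rw [(monic_X_sub_C _).natDegree_mul hm, natDegree_X_sub_C, add_comm]
  have h3 : (C (1 / 2) * derivative P).degree < ((X - C (a / 2)) * P).degree := by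
    rw [degree_eq_natDegree h1.ne_zero, h2]
    refine lt_of_le_of_lt degree_le_natDegree ?_
    have := natDegree_C_mul_le (1 / 2 : ℝ) (derivative P)
    have := natDegree_derivative_le P
    exact_mod_cast (by omega)
  refine ⟨h1.sub_of_left h3, ?_⟩
  rw [← h2]
  exact natDegree_eq_of_degree_eq (degree_sub_eq_left_of_degree_lt h3)

/-- Orthogonality conditions. -/
def Orth {r : ℕ} (c : Fin r → ℝ) (n : Fin r → ℕ) (P : ℝ[X]) : Prop :=
  ∀ j : Fin r, ∀ k < n j, wInt (c j) (X ^ k * P) = 0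

lemma IsMultipleHermite.orth {r : ℕ} {c : Fin r → ℝ} {n : Fin r → ℕ} {P : ℝ[X]}
    (h : IsMultipleHermite c n P) : Orth c n P := by
  intro j k hk
  have := h.2.2 j k hk
  simpa [wInt] using this

/-- Induction invariant. -/
structure HermInv {r : ℕ} (c : Fin r → ℝ) (n : Fin r → ℕ) (P : ℝ[X]) : Prop where
  uniq : ∀ D : ℝ[X], D.degree < ((∑ i, n i : ℕ) : WithBot ℕ) → Orth c n D → D = 0
  nondeg : ∀ j, wInt (c j) (X ^ (n j) * P) ≠ 0
  splits : P.Splits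
  simple : ∀ x, P.eval x = 0 → (derivative P).eval x ≠ 0

lemma sum_unit {r : ℕ} (m : Fin r → ℕ) (i : Fin r) :
    ∑ l, (m + unitMI i) l = ∑ l, m l + 1 := by
  simp [unitMI, Finset.sum_add_distrib]

lemma orth_raise {r : ℕ} {c : Fin r → ℝ} {m : Fin r → ℕ} {P : ℝ[X]} (h : Orth c m P)
    (i : Fin r) : Orth c (m + unitMI i) (raiseOp (c i) P) := by
  intro j k hk
  rw [wInt_raise_pow]
  have h1 : (k : ℝ) / 2 * wInt (c j) (X ^ (k - 1) * P) = 0 := by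
    rcases Nat.eq_zero_or_pos k with h0 | h0
    · simp [h0]
    · rw [h j (k - 1), mul_zero]
      simp only [unitMI, Pi.add_apply] at hk
      split_ifs at hk <;> omega
  rw [h1, zero_add]
  by_cases hij : j = i
  · simp [hij]
  · rw [h j k, mul_zero]
    simpa [unitMI, hij] using hk

lemma HermInv.uniq_step {r : ℕ} {c : Fin r → ℝ} {m : Fin r → ℕ} {P : ℝ[X]}
    (hP : IsMultipleHermite c m P) (h : HermInv c m P) (i : Fin r) (D : ℝ[X])
    (hd : D.degree < ((∑ l, (m + unitMI i) l : ℕ) : WithBot ℕ))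
    (ho : Orth c (m + unitMI i) D) : D = 0 := by
  rw [sum_unit] at hd
  set N := ∑ l, m l with hN
  have key : D - C (D.coeff N) * P = 0 := by
    apply h.uniq
    · rw [degree_lt_iff_coeff_zero]
      intro k hk
      rcases eq_or_lt_of_le hk with hk | hk
      · have : P.coeff N = 1 := by
          have := hP.1.coeff_natDegree
          rwa [hP.2.1] at this
        simp [← hk, ← hN, this]
      · have h1 : D.coeff k = 0 := (degree_lt_iff_coeff_zero _ _).1 hd k hk
        have h2 : P.coeff k = 0 := coeff_eq_zero_of_natDegree_lt (by rw [hP.2.1]; exact hk)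
        simp [h1, h2]
    · intro j k hk
      have e : X ^ k * (D - C (D.coeff N) * P) = X ^ k * D - C (D.coeff N) * (X ^ k * P) := by
        ring
      rw [e, wInt_sub, wInt_C_mul, hP.orth j k hk, ho j k (by simp; omega)]
      simp
  have hD : D = C (D.coeff N) * P := sub_eq_zero.1 key
  have h2 := ho i (m i) (by simp [unitMI])
  have e : X ^ m i * D = C (D.coeff N) * (X ^ m i * P) := by
    conv_lhs => rw [hD]
    ring
  rw [e, wInt_C_mul] at h2
  have h3 := (mul_eq_zero.1 h2).resolve_right (h.nondeg i)
  rw [hD, h3]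
  simp

lemma HermInv.raise_eq {r : ℕ} {c : Fin r → ℝ} {m : Fin r → ℕ} {P Q : ℝ[X]}
    (hP : IsMultipleHermite c m P) (h : HermInv c m P) (i : Fin r)
    (hQ : IsMultipleHermite c (m + unitMI i) Q) : Q = raiseOp (c i) P := by
  obtain ⟨h1, h2⟩ := raise_monic hP.1 (c i)
  have hdeg : Q.natDegree = (raiseOp (c i) P).natDegree := by
    rw [hQ.2.1, h2, hP.2.1, sum_unit]
  refine sub_eq_zero.1 (h.uniq_step hP i _ ?_ ?_)
  · rw [← hQ.2.1, ← degree_eq_natDegree hQ.1.ne_zero]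
    refine degree_sub_lt ?_ hQ.1.ne_zero ?_
    · rw [degree_eq_natDegree hQ.1.ne_zero, degree_eq_natDegree h1.ne_zero, hdeg]
    · rw [hQ.1.leadingCoeff, h1.leadingCoeff]
  · intro j k hk
    rw [mul_sub, wInt_sub, hQ.orth j k hk, orth_raise hP.orth i j k hk, sub_zero]

lemma HermInv.step {r : ℕ} {c : Fin r → ℝ} (hc : Function.Injective c) {m : Fin r → ℕ} {P Q : ℝ[X]}
    (hP : IsMultipleHermite c m P) (h : HermInv c m P) (i : Fin r)
    (hQ : IsMultipleHermite c (m + unitMI i) Q) : HermInv c (m + unitMI i) Q := by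
  have e := h.raise_eq hP i hQ
  refine ⟨h.uniq_step hP i, ?_, ?_, ?_⟩
  · intro j
    rw [e, wInt_raise_pow]
    by_cases hij : j = i
    · subst hij
      have := h.nondeg j
      have h4 : ((m j : ℝ) + 1) / 2 ≠ 0 := by positivity
      simpa [unitMI] using mul_ne_zero h4 this
    · have h5 : (c j - c i) / 2 ≠ 0 := by
        have := hc.ne hij
        exact div_ne_zero (sub_ne_zero.2 this) two_ne_zero
      have h6 : (m + unitMI i) j = m j := by simp [unitMI, hij]
      rw [h6]
      have h1 : (m j : ℝ) / 2 * wInt (c j) (X ^ (m j - 1) * P) = 0 := by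
        rcases Nat.eq_zero_or_pos (m j) with h0 | h0
        · simp [h0]
        · rw [hP.orth j (m j - 1) (by omega), mul_zero]
      rw [h1, zero_add]
      exact mul_ne_zero h5 (h.nondeg j)
  · rw [e]
    exact raise_splits h.splits hP.1 _ (raise_monic hP.1 _).1
  · rw [e]
    exact raise_simple h.splits hP.1 h.simple _

lemma inv_all {r : ℕ} {c : Fin r → ℝ} (hc : Function.Injective c)
    (H : (Fin r → ℕ) → ℝ[X]) (hH : ∀ n, IsMultipleHermite c n (H n)) :
    ∀ (N : ℕ) (n : Fin r → ℕ), ∑ i, n i = N → HermInv c n (H n) := by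
  intro N
  induction N with
  | zero =>
    intro n hn
    have h1 : H n = 1 := (hH n).1.natDegree_eq_zero.1 ((hH n).2.1.trans hn)
    have h0 : ∀ j, n j = 0 := by
      intro j
      have := (Finset.sum_eq_zero_iff.1 hn) j (Finset.mem_univ j)
      exact this
    rw [h1]
    refine ⟨?_, ?_, ?_, ?_⟩
    · intro D hD _
      rw [hn] at hD
      exact degree_lt_iff_coeff_zero D 0 |>.1 hD |> fun h => by ext k; simpa using h k (Nat.zero_le k)
    · intro j
      rw [h0 j]
      simpa using (wInt_one_pos (c j)).ne'
    · exact Splits.one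
    · intro x hx
      simp at hx
  | succ N ih =>
    intro n hn
    obtain ⟨i, hi⟩ : ∃ i, n i ≠ 0 := by
      by_contra! h
      simp [h] at hn
    have hnm : n = (fun l => n l - unitMI i l) + unitMI i := by
      funext l
      simp only [Pi.add_apply, unitMI]
      split_ifs with hl
      · subst hl
        omega
      · simp
    generalize (fun l => n l - unitMI i l) = m at hnm
    subst hnm
    rw [sum_unit] at hn
    exact (ih m (by omega)).step hc (hH m) i (hH _)

/-- the multiple Hermite polynomials satisfy the Turán-type inequality
`H_{n+e_j}(x) H_{n+e_k}(x) − H_{n}(x) H_{n+e_j+e_k}(x) > 0` for all real `x`. -/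
theorem multipleHermite_turan {r : ℕ} (hr : 1 ≤ r)
    (c : Fin r → ℝ) (hc : Function.Injective c)
    (H : (Fin r → ℕ) → Polynomial ℝ) (hH : ∀ n, IsMultipleHermite c n (H n))
    (n : Fin r → ℕ) (j k : Fin r) (x : ℝ) :
    0 < (H (n + unitMI j)).eval x * (H (n + unitMI k)).eval x -
        (H n).eval x * (H (n + unitMI j + unitMI k)).eval x := by
  have hI := inv_all hc H hH _ n rfl
  have ej := hI.raise_eq (hH n) j (hH _)
  have ek := hI.raise_eq (hH n) k (hH _)
  have ejk := (inv_all hc H hH _ (n + unitMI j) rfl).raise_eq (hH _) k (hH _)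
  have hw := wr_pos hI.splits (hH n).1 hI.simple x
  rw [ejk, ek, ej]
  generalize H n = P at hw
  simp [raiseOp]
  nlinarith
end

section
/- For every multi-index n⃗ ∈ ℕ^r and every j ∈ {1, …, r}, the 2×2 Wronskian of consecutive multiple Hermite polynomials is strictly positive for all real x: H_{n⃗}(x) · H_{n⃗+e⃗_j}′(x) − H_{n⃗}′(x) · H_{n⃗+e⃗_j}(x) > 0 for all x ∈ ℝ. -/
open MeasureTheory Polynomial Finset

/-- The operator sending p to twice X p minus its derivative. -/
noncomputable def mhA : Module.End ℝ ℝ[X] :=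
  (2 : ℝ) • LinearMap.mulLeft ℝ (X : ℝ[X]) - derivative

/-- `S G = G(A) 1`. -/
noncomputable def mhS (G : ℝ[X]) : ℝ[X] := (aeval mhA G) 1

lemma mhA_apply (p : ℝ[X]) : mhA p = 2 * X * p - derivative p := by
  have e : (2 : ℝ[X]) = C 2 := rfl
  rw [e, mul_assoc, ← smul_eq_C_mul]
  rfl

lemma mhS_add (p q : ℝ[X]) : mhS (p + q) = mhS p + mhS q := by simp [mhS]

lemma mhS_C (a : ℝ) : mhS (C a) = C a := by
  simp [mhS, Module.algebraMap_end_apply, smul_eq_C_mul]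

lemma mhS_C_mul (a : ℝ) (p : ℝ[X]) : mhS (C a * p) = C a * mhS p := by
  simp [mhS, Module.algebraMap_end_apply, smul_eq_C_mul]

lemma mhS_X_mul (p : ℝ[X]) : mhS (X * p) = mhA (mhS p) := by
  simp [mhS]

lemma mhS_sub (p q : ℝ[X]) : mhS (p - q) = mhS p - mhS q := by simp [mhS]

lemma mh_induction {motive : ℝ[X] → Prop} (hC : ∀ a, motive (C a))
    (hadd : ∀ p q, motive p → motive q → motive (p + q))
    (hX : ∀ p, motive p → motive (X * p)) (p : ℝ[X]) : motive p := by
  induction p using Polynomial.induction_on with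
  | C a => exact hC a
  | add p q hp hq => exact hadd p q hp hq
  | monomial n a h =>
    have := hX _ h
    rwa [show X * (C a * X ^ n) = C a * X ^ (n + 1) by ring] at this

lemma mhS_derivative (G : ℝ[X]) : derivative (mhS G) = mhS (C 2 * derivative G) := by
  induction G using mh_induction with
  | hC a => simp [mhS_C]; simp [mhS]
  | hadd p q hp hq => simp only [mhS_add, derivative_add, mul_add, hp, hq]
  | hX p hp =>
    have e : C (2:ℝ) * derivative (X * p) = C 2 * p + X * (C 2 * derivative p) := by
      simp [derivative_mul]; ring
    rw [e, mhS_add, mhS_X_mul, mhS_X_mul, ← hp, mhS_C_mul, mhA_apply, mhA_apply,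
      show C (2 : ℝ) = (2 : ℝ[X]) from rfl]
    simp [derivative_mul]
    ring

lemma X_mul_mhS (G : ℝ[X]) : X * mhS G = mhS (C (1/2) * (X * G) + derivative G) := by
  have h := mhS_derivative G
  rw [mhS_C_mul] at h
  rw [mhS_add, mhS_C_mul, mhS_X_mul, mhA_apply, h]
  have e : (2 : ℝ[X]) = C 2 := rfl
  have e2 : C (1/2 : ℝ) * C 2 = 1 := by rw [← C_mul]; norm_num
  rw [e]
  linear_combination (mhS (derivative G) - X * mhS G) * e2

lemma mhS_surj (p : ℝ[X]) : ∃ G, mhS G = p := by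
  induction p using mh_induction with
  | hC a => exact ⟨C a, mhS_C a⟩
  | hadd p q hp hq =>
    obtain ⟨G, rfl⟩ := hp
    obtain ⟨K, rfl⟩ := hq
    exact ⟨G + K, mhS_add _ _⟩
  | hX p hp =>
    obtain ⟨G, rfl⟩ := hp
    exact ⟨_, (X_mul_mhS G).symm⟩

lemma mhS_degree (N : ℕ) : ∀ G : ℝ[X], G.natDegree ≤ N →
    (mhS G).natDegree ≤ N ∧ (mhS G).coeff N = 2 ^ N * G.coeff N := by
  induction N with
  | zero =>
    intro G hG
    obtain ⟨a, rfl⟩ := natDegree_eq_zero.1 (Nat.le_zero.1 hG)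
    simp [mhS_C]
  | succ N ih =>
    intro G hG
    have hd : (divX G).natDegree ≤ N := by
      rw [natDegree_divX_eq_natDegree_tsub_one]; omega
    obtain ⟨h1, h2⟩ := ih _ hd
    have e : mhS G = (2 * X * mhS (divX G) - derivative (mhS (divX G))) + C (G.coeff 0) := by
      conv_lhs => rw [← X_mul_divX_add G]
      rw [mhS_add, mhS_C, mhS_X_mul, mhA_apply]
    have key : ∀ k, (mhS G).coeff (k + 1) = 2 * (mhS (divX G)).coeff k
        - (mhS (divX G)).coeff (k + 2) * (k + 2) := by
      intro k
      rw [e, coeff_add, coeff_sub, mul_assoc, coeff_ofNat_mul, coeff_X_mul, coeff_derivative,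
        coeff_C_succ]
      push_cast
      ring
    refine ⟨?_, ?_⟩
    · rw [natDegree_le_iff_coeff_eq_zero]
      intro k hk
      obtain ⟨k, rfl⟩ : ∃ l, k = l + 1 := ⟨k - 1, by omega⟩
      rw [key, coeff_eq_zero_of_natDegree_lt (by omega), coeff_eq_zero_of_natDegree_lt (by omega)]
      simp
    · rw [key, h2, coeff_eq_zero_of_natDegree_lt (p := mhS (divX G)) (n := N + 2) (by omega), coeff_divX]
      ring

lemma mh_integrable (c : ℝ) (p : ℝ[X]) :
    Integrable fun x : ℝ => p.eval x * Real.exp (-x ^ 2 + c * x) := by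
  have h0 : ∀ q : ℝ[X], Integrable fun x : ℝ => q.eval x * Real.exp (-x ^ 2) := by
    intro q
    induction q using Polynomial.induction_on' with
    | add p q hp hq => 
      have := hp.add hq
      refine this.congr (Filter.Eventually.of_forall fun x => ?_)
      simp [add_mul]
    | monomial n a =>
      have := (integrable_rpow_mul_exp_neg_mul_sq (b := 1) one_pos (s := n)
        (by have : (0:ℝ) ≤ n := n.cast_nonneg
            linarith)).const_mul a
      simpa [mul_assoc] using this
  have h1 := ((h0 (p.comp (X + C (c/2)))).comp_sub_right (c/2)).const_mul (Real.exp (c^2/4))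
  refine h1.congr (Filter.Eventually.of_forall fun x => ?_)
  change Real.exp (c ^ 2 / 4) * (eval (x - c / 2) (p.comp (X + C (c / 2))) *
    Real.exp (-(x - c / 2) ^ 2)) = _
  rw [mul_left_comm, ← Real.exp_add]
  simp only [eval_comp, eval_add, eval_X, eval_C, sub_add_cancel]
  congr 2
  ring

/-- the functional -/
noncomputable def mhL (c : ℝ) (p : ℝ[X]) : ℝ := ∫ x : ℝ, p.eval x * Real.exp (-x ^ 2 + c * x)

lemma mhL_add (c : ℝ) (p q : ℝ[X]) : mhL c (p + q) = mhL c p + mhL c q := by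
  simp only [mhL, eval_add, add_mul]
  exact integral_add (mh_integrable c p) (mh_integrable c q)

lemma mhL_C_mul (c a : ℝ) (q : ℝ[X]) : mhL c (C a * q) = a * mhL c q := by
  simp only [mhL, eval_mul, eval_C, mul_assoc]
  exact integral_const_mul _ _

lemma mhL_A (c : ℝ) (p : ℝ[X]) : mhL c (mhA p) = c * mhL c p := by
  have h : mhL c (derivative p + (C c - 2 * X) * p) = 0 := by
    refine integral_eq_zero_of_hasDerivAt_of_integrable
      (f := fun x => p.eval x * Real.exp (-x ^ 2 + c * x)) ?_ (mh_integrable _ _)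
      (mh_integrable _ _)
    intro x
    have h1 : HasDerivAt (fun x : ℝ => -x ^ 2 + c * x) (-(2 * x) + c) x := by
      have := ((hasDerivAt_pow 2 x).neg).add ((hasDerivAt_id x).const_mul c)
      refine this.congr_deriv ?_
      simp
    refine ((p.hasDerivAt x).mul h1.exp).congr_deriv ?_
    simp
    ring
  have e : C c * p = mhA p + (derivative p + (C c - 2 * X) * p) := by
    rw [mhA_apply]; ring
  have := mhL_C_mul c c p
  rw [e, mhL_add, h] at this
  linarith

lemma mhL_S (c : ℝ) (G : ℝ[X]) : mhL c (mhS G) = G.eval c * mhL c 1 := by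
  induction G using mh_induction with
  | hC a => 
    have := mhL_C_mul c a 1
    simpa [mhS_C] using this
  | hadd p q hp hq => rw [mhS_add, mhL_add, hp, hq, eval_add]; ring
  | hX p hp => rw [mhS_X_mul, mhL_A, hp, eval_mul, eval_X]; ring

lemma mhL_one_pos (c : ℝ) : 0 < mhL c 1 := by
  have h := mh_integrable c 1
  simp only [eval_one, one_mul] at h
  simp only [mhL, eval_one, one_mul]
  exact integral_exp_pos h

/-- multiplication by `x` on the symbol side -/
noncomputable def mhT (G : ℝ[X]) : ℝ[X] := C (1/2) * (X * G) + derivative G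

lemma X_pow_mul_mhS (k : ℕ) (G : ℝ[X]) : X ^ k * mhS G = mhS (mhT^[k] G) := by
  induction k generalizing G with
  | zero => simp
  | succ k ih => rw [Function.iterate_succ_apply, ← ih, pow_succ, mul_assoc, X_mul_mhS, mhT]

lemma mh_dvd (c : ℝ) (m : ℕ) : ∀ G : ℝ[X], (∀ k < m, (mhT^[k] G).eval c = 0) →
    (X - C c) ^ m ∣ G := by
  induction m with
  | zero => simp
  | succ m ih =>
    intro G hG
    have h1 : (X - C c) ^ m ∣ G := ih G fun k hk => hG k (by omega)
    have h2 : (X - C c) ^ m ∣ mhT G := ih _ fun k hk => by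
      have := hG (k + 1) (by omega)
      rwa [Function.iterate_succ_apply] at this
    have h3 : (X - C c) ^ m ∣ derivative G :=
      (dvd_add_right ((h1.mul_left X).mul_left (C (1/2)))).1 h2
    have h0 : G.IsRoot c := hG 0 (by omega)
    by_cases hz : G = 0
    · simp [hz]
    have hz' : derivative G ≠ 0 := by
      intro h
      obtain ⟨a, rfl⟩ := natDegree_eq_zero.1 (derivative_eq_zero.1 h)
      simp [IsRoot] at h0
      simp [h0] at hz
    rw [← le_rootMultiplicity_iff hz]
    have h4 := (le_rootMultiplicity_iff hz').2 h3
    rw [derivative_rootMultiplicity_of_root h0] at h4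
    have := (rootMultiplicity_pos hz).2 h0
    omega

lemma mh_repr {r : ℕ} (c : Fin r → ℝ) (hc : Function.Injective c) (n : Fin r → ℕ) (P : ℝ[X])
    (h : IsMultipleHermite c n P) :
    P = C ((1/2) ^ (∑ i, n i)) * mhS (∏ i, (X - C (c i)) ^ n i) := by
  obtain ⟨hm, hd, ho⟩ := h
  obtain ⟨G, rfl⟩ := mhS_surj P
  have hdvd : ∏ i, (X - C (c i)) ^ n i ∣ G := by
    refine Finset.prod_dvd_of_coprime ?_ ?_
    · intro i _ j _ hij
      exact (pairwise_coprime_X_sub_C hc hij).pow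
    · intro i _
      refine mh_dvd _ _ _ fun k hk => ?_
      have := ho i k hk
      have e : mhL (c i) (X ^ k * mhS G) = 0 := by simpa [mhL] using this
      rw [X_pow_mul_mhS, mhL_S] at e
      exact (mul_eq_zero.1 e).resolve_right (mhL_one_pos _).ne'
  have hM : (∏ i, (X - C (c i)) ^ n i).Monic := monic_prod_of_monic _ _ fun i _ =>
    (monic_X_sub_C _).pow _
  have hMd : (∏ i, (X - C (c i)) ^ n i).natDegree = ∑ i, n i := by
    rw [natDegree_prod_of_monic _ _ fun i _ => (monic_X_sub_C _).pow _]
    simp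
  have hG0 : G ≠ 0 := by
    rintro rfl
    have : mhS 0 = 0 := by simp [mhS]
    rw [this] at hm
    exact hm.ne_zero rfl
  obtain ⟨h1, h2⟩ := mhS_degree G.natDegree G le_rfl
  have hdeg : (mhS G).natDegree = G.natDegree := by
    refine le_antisymm h1 (le_natDegree_of_ne_zero ?_)
    rw [h2]
    have : G.coeff G.natDegree ≠ 0 := leadingCoeff_ne_zero.2 hG0
    positivity
  have hlc : 1 = 2 ^ G.natDegree * G.leadingCoeff := by
    rw [← hdeg, coeff_natDegree, hm.leadingCoeff, hdeg] at h2
    exact h2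
  have hGM := eq_leadingCoeff_mul_of_monic_of_dvd_of_natDegree_le hM hdvd
    (by rw [hMd, ← hd, hdeg])
  rw [← mhS_C_mul]
  congr 1
  rw [← hd, hdeg]
  have : (1/2 : ℝ) ^ G.natDegree = G.leadingCoeff := by
    rw [one_div, inv_pow]
    exact inv_eq_of_mul_eq_one_right hlc.symm
  rw [this]
  exact hGM

lemma mh_raise {r : ℕ} (c : Fin r → ℝ) (hc : Function.Injective c)
    (H : (Fin r → ℕ) → Polynomial ℝ) (hH : ∀ n, IsMultipleHermite c n (H n))
    (n : Fin r → ℕ) (j : Fin r) :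
    H (n + unitMI j) = (X - C (c j / 2)) * H n - C (1/2) * derivative (H n) := by
  have h1 := mh_repr c hc _ _ (hH n)
  have h2 := mh_repr c hc _ _ (hH (n + unitMI j))
  have hs : ∑ i, (n + unitMI j) i = ∑ i, n i + 1 := by
    simp [unitMI, Finset.sum_add_distrib]
  have hp : ∏ i, (X - C (c i)) ^ ((n + unitMI j) i) =
      X * (∏ i, (X - C (c i)) ^ (n i)) - C (c j) * ∏ i, (X - C (c i)) ^ (n i) := by
    have e : ∏ i, (X - C (c i)) ^ (unitMI j i) = X - C (c j) := by
      rw [Finset.prod_eq_single j]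
      · simp [unitMI]
      · intro i _ hi
        simp [unitMI, hi]
      · simp
    simp only [Pi.add_apply, pow_add, Finset.prod_mul_distrib, e]
    ring
  rw [hs, hp, mhS_sub, mhS_X_mul, mhS_C_mul, mhA_apply] at h2
  rw [h2, h1]
  have e2 : C (1/2 : ℝ) * 2 = 1 := by rw [show (2:ℝ[X]) = C 2 from rfl, ← C_mul]; norm_num
  have e3 : C (c j / 2) = C (1/2) * C (c j) := by rw [← C_mul]; congr 1; ring
  rw [pow_succ, C_mul, e3, derivative_C_mul]
  generalize mhS _ = Q
  linear_combination (C ((1/2 : ℝ) ^ ∑ i, n i)) * X * Q * e2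

lemma mh_laguerre (s : Multiset ℝ) (x : ℝ) :
    0 ≤ ((s.map (X - C ·)).prod.derivative.eval x) ^ 2 -
      (s.map (X - C ·)).prod.eval x * (s.map (X - C ·)).prod.derivative.derivative.eval x := by
  induction s using Multiset.induction with
  | empty => simp
  | cons a s ih =>
    rw [Multiset.map_cons, Multiset.prod_cons]
    generalize (s.map (X - C ·)).prod = P at ih ⊢
    simp [derivative_mul]
    nlinarith [mul_nonneg (sq_nonneg (x - a)) ih, sq_nonneg (P.eval x)]

lemma mh_upper (s : Multiset ℝ) (z : ℂ) (hz : 0 < z.im) :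
    (aeval z (s.map (X - C ·)).prod ≠ 0) ∧
    (aeval z (s.map (X - C ·)).prod.derivative *
      (starRingEnd ℂ) (aeval z (s.map (X - C ·)).prod)).im ≤ 0 := by
  induction s using Multiset.induction with
  | empty => simp
  | cons a s ih =>
    rw [Multiset.map_cons, Multiset.prod_cons]
    generalize (s.map (X - C ·)).prod = P at ih ⊢
    obtain ⟨h0, ih⟩ := ih
    simp only [derivative_mul, derivative_sub, derivative_X, derivative_C, sub_zero, one_mul,
      map_add, map_mul, map_sub, aeval_X, aeval_C]
    generalize aeval z P = w at *
    generalize aeval z (derivative P) = v at *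
    refine ⟨mul_ne_zero ?_ h0, ?_⟩
    · intro h
      have := congrArg Complex.im h
      simp at this
      exact hz.ne' this
    · simp at ih ⊢
      nlinarith [mul_nonneg (sub_nonneg.2 ih)
        (add_nonneg (sq_nonneg (z.re - a)) (sq_nonneg z.im)),
        mul_nonneg hz.le (add_nonneg (sq_nonneg w.re) (sq_nonneg w.im))]

lemma mh_no_upper (P Q : ℝ[X]) (c : ℝ) (hm : P.Monic) (hs : P.Splits)
    (hQ : Q = (X - C (c / 2)) * P - C (1/2) * derivative P) (z : ℂ) (hz : 0 < z.im) :
    aeval z Q ≠ 0 := by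
  intro h
  obtain ⟨h0, h1⟩ := mh_upper P.roots z hz
  rw [← hs.eq_prod_roots_of_monic hm] at h0 h1
  rw [hQ] at h
  simp only [map_mul, map_sub, aeval_X, aeval_C] at h
  generalize aeval z P = w at *
  generalize aeval z (derivative P) = v at *
  have hv : v = 2 * (z - (c / 2 : ℝ)) * w := by
    have h' : (z - ((c / 2 : ℝ) : ℂ)) * w - ((1 / 2 : ℝ) : ℂ) * v = 0 := h
    push_cast at h' ⊢
    linear_combination (-2) * h'
  rw [hv, mul_assoc, Complex.mul_conj] at h1
  have hw := Complex.normSq_pos.2 h0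
  simp at h1
  nlinarith [mul_pos hz hw]

lemma mh_wronskian (P Q : ℝ[X]) (c : ℝ) (hm : P.Monic) (hs : P.Splits)
    (hsimple : ∀ x, P.eval x = 0 → P.derivative.eval x ≠ 0)
    (hQ : Q = (X - C (c / 2)) * P - C (1/2) * derivative P) (x : ℝ) :
    0 < P.eval x * Q.derivative.eval x - P.derivative.eval x * Q.eval x := by
  have hl := mh_laguerre P.roots x
  rw [← hs.eq_prod_roots_of_monic hm] at hl
  have e : P.eval x * Q.derivative.eval x - P.derivative.eval x * Q.eval x =
      P.eval x ^ 2 + (P.derivative.eval x ^ 2 - P.eval x * P.derivative.derivative.eval x) / 2 := by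
    rw [hQ]
    simp [derivative_mul]
    ring
  rw [e]
  by_cases h : P.eval x = 0
  · have := hsimple x h
    rw [h]
    have : 0 < P.derivative.eval x ^ 2 := by positivity
    linarith
  · have : 0 < P.eval x ^ 2 := by positivity
    linarith

lemma mh_splits (P Q : ℝ[X]) (c : ℝ) (hm : P.Monic) (hs : P.Splits)
    (hQ : Q = (X - C (c / 2)) * P - C (1/2) * derivative P) : Q.Splits := by
  refine Splits.of_splits_map (algebraMap ℝ ℂ) (IsAlgClosed.splits _) fun z hz => ?_
  have hz0 : aeval z Q = 0 := by
    have := isRoot_of_mem_roots hz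
    rwa [IsRoot, eval_map_algebraMap] at this
  have him : z.im = 0 := by
    rcases lt_trichotomy z.im 0 with h | h | h
    · exfalso
      refine mh_no_upper P Q c hm hs hQ ((starRingEnd ℂ) z) (by simpa using h) ?_
      rw [aeval_conj, hz0, map_zero]
    · exact h
    · exact absurd hz0 (mh_no_upper P Q c hm hs hQ z h)
  exact ⟨z.re, Complex.ext (by simp) (by simp [him])⟩

lemma mh_good {r : ℕ} (c : Fin r → ℝ) (hc : Function.Injective c)
    (H : (Fin r → ℕ) → Polynomial ℝ) (hH : ∀ n, IsMultipleHermite c n (H n)) (N : ℕ) :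
    ∀ n : Fin r → ℕ, ∑ i, n i = N → (H n).Splits ∧
      ∀ x, (H n).eval x = 0 → (H n).derivative.eval x ≠ 0 := by
  induction N with
  | zero =>
    intro n hn
    have h1 : H n = 1 := (hH n).1.natDegree_eq_zero.1 ((hH n).2.1.trans hn)
    rw [h1]
    simp
  | succ N ih =>
    intro n hn
    obtain ⟨j, hj⟩ : ∃ j, n j ≠ 0 := by
      by_contra! h
      simp [h] at hn
    obtain ⟨m, rfl⟩ : ∃ m, n = m + unitMI j := by
      refine ⟨n - unitMI j, ?_⟩
      funext i
      by_cases hi : i = j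
      · subst hi; simp [unitMI]; omega
      · simp [unitMI, hi]
    have hs : ∑ i, (m + unitMI j) i = ∑ i, m i + 1 := by
      simp [unitMI, Finset.sum_add_distrib]
    obtain ⟨h1, h2⟩ := ih m (by omega)
    have hr := mh_raise c hc H hH m j
    refine ⟨mh_splits _ _ (c j) (hH m).1 h1 hr, fun x hx hx' => ?_⟩
    have := mh_wronskian _ _ (c j) (hH m).1 h1 h2 hr x
    rw [hx, hx'] at this
    simp at this

/-- the 2×2 Wronskian of consecutive multiple Hermite polynomials is
strictly positive: `H_n(x) H_{n+e_j}′(x) − H_n′(x) H_{n+e_j}(x) > 0` for all real `x`. -/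
theorem multipleHermite_wronskian_pos {r : ℕ} (hr : 1 ≤ r)
    (c : Fin r → ℝ) (hc : Function.Injective c)
    (H : (Fin r → ℕ) → Polynomial ℝ) (hH : ∀ n, IsMultipleHermite c n (H n))
    (n : Fin r → ℕ) (j : Fin r) (x : ℝ) :
    0 < (H n).eval x * ((H (n + unitMI j)).derivative).eval x -
        ((H n).derivative).eval x * (H (n + unitMI j)).eval x := by
  obtain ⟨h1, h2⟩ := mh_good c hc H hH _ n rfl
  exact mh_wronskian _ _ (c j) (hH n).1 h1 h2 (mh_raise c hc H hH n j) x
end
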